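/- arXiv:1604.00573 — 4 statements merged into one kernel-verified Lean document; each statement's English description precedes it below -/
import Mathlib

section
/- There exists a group 𝒢 containing at least two distinct involutions such that: (a) for any two distinct involutions r, s of 𝒢 the product r·s has infinite order; (b) for all involutions a, b, c, d of 𝒢 with a ≠ b and c ≠ d there is a unique g ∈ 𝒢 with g⁻¹·a·g = c and g⁻¹·b·g = d (that is, 𝒢 acts sharply 2-transitively by conjugation on its set of involutions, in characteristic 0); and (c) every abelian normal subgroup of 𝒢 is trivial. -/
/-- An involution: an element of order 2. -/
def IsInvol {G : Type*} [Group G] (s : G) : Prop := orderOf s = 2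

/-- `s₁ ∼_j s₂`: there are nonzero integers `m, n` with `(j·s₁)^m = (j·s₂)^n`. -/
def JEquiv {G : Type*} [Group G] (j s₁ s₂ : G) : Prop :=
  ∃ m n : ℤ, m ≠ 0 ∧ n ≠ 0 ∧ (j * s₁) ^ m = (j * s₂) ^ n

/-- `s₁` is minimal relative to `j`: `⟨j, s₂⟩ ≤ ⟨j, s₁⟩` for every involution `s₂ ∼_j s₁`. -/
def JMinimal {G : Type*} [Group G] (j s₁ : G) : Prop :=
  ∀ s₂ : G, IsInvol s₂ → JEquiv j s₂ s₁ →
    Subgroup.closure ({j, s₂} : Set G) ≤ Subgroup.closure ({j, s₁} : Set G)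

/-- The standing hypotheses (1)–(6) on `G`, `j`, `t`, `t'`. -/
structure StandingHyp {G : Type*} [Group G] (j t t' : G) : Prop where
  invol_j : IsInvol j
  invol_t : IsInvol t
  invol_t' : IsInvol t'
  tconj : t' * j * t' = t
  all_conj : ∀ s₁ s₂ : G, IsInvol s₁ → IsInvol s₂ → IsConj s₁ s₂
  infinite_order : ∀ r s : G, IsInvol r → IsInvol s → r ≠ s → ¬ IsOfFinOrder (r * s)
  unique_root : ∀ n : ℕ, 0 < n → ∃! s : G, IsInvol s ∧ (j * s) ^ n = j * t
  conj_in_A : ∀ s : G, IsInvol s → JEquiv j s t →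
      ∃ a ∈ Subgroup.centralizer ({j} : Set G), a⁻¹ * t * a = s
  centralizer_eq : ∀ s : G, IsInvol s → s ≠ j → ∀ x : G,
      x ∈ Subgroup.centralizer ({j * s} : Set G) ↔
        x = 1 ∨ ∃ s' : G, IsInvol s' ∧ JEquiv j s' s ∧ x = j * s'
  unique_minimal : ∀ s : G, IsInvol s →
      ¬ (∃ a ∈ Subgroup.centralizer ({j} : Set G),
           ∃ b ∈ Subgroup.centralizer ({j} : Set G), s = a * t * b) →
      ∃! s' : G, IsInvol s' ∧ JEquiv j s' s ∧ JMinimal j s'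

/-- An integer-valued distance function of a tree, characterised by the fact that from any point
there is exactly one step towards any other given point. -/
structure IsTreeDist {V : Type*} (d : V → V → ℕ) : Prop where
  eq_zero_iff : ∀ x y, d x y = 0 ↔ x = y
  adj_symm : ∀ x y, d x y = 1 → d y x = 1
  exists_next : ∀ x y, x ≠ y →
    ∃ z, d x z = 1 ∧ d z y + 1 = d x y ∧ ∀ w, d x w = 1 → w ≠ z → d w y = d x y + 1

namespace IsTreeDist

variable {V : Type*} {d : V → V → ℕ}

lemma self (hd : IsTreeDist d) (x : V) : d x x = 0 := (hd.eq_zero_iff x x).2 rfl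

lemma le_of_adj (hd : IsTreeDist d) {x w : V} (h : d x w = 1) (y : V) : d x y ≤ d w y + 1 := by
  by_cases hxy : x = y
  · subst hxy; simp [hd.self]
  · obtain ⟨z, -, hz, hw⟩ := hd.exists_next x y hxy
    by_cases hwz : w = z
    · subst hwz; omega
    · have := hw w h hwz; omega

lemma triangle (hd : IsTreeDist d) (x y z : V) : d x z ≤ d x y + d y z := by
  induction hn : d x y generalizing x with
  | zero => rw [(hd.eq_zero_iff _ _).1 hn]; omega
  | succ n ih =>
    obtain ⟨w, hw, hw', -⟩ := hd.exists_next x y (by rintro rfl; simp [hd.self] at hn)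
    have := ih w (by omega)
    have := hd.le_of_adj hw z
    omega

lemma symm (hd : IsTreeDist d) (x y : V) : d x y = d y x := by
  suffices h : ∀ n x y, d x y = n → d y x ≤ n by
    exact le_antisymm (h _ y x rfl) (h _ x y rfl)
  intro n
  induction n with
  | zero => intro x y h; rw [(hd.eq_zero_iff _ _).1 h]; simp [hd.self]
  | succ n ih =>
    intro x y hn
    obtain ⟨w, hw, hw', -⟩ := hd.exists_next x y (by rintro rfl; simp [hd.self] at hn)
    have h1 := ih w y (by omega)
    have h2 := hd.triangle y w x
    have h3 := hd.adj_symm _ _ hw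
    omega

lemma adj_dist (hd : IsTreeDist d) {x w : V} (h : d x w = 1) (y : V) :
    d w y + 1 = d x y ∨ d w y = d x y + 1 := by
  by_cases hxy : x = y
  · subst hxy; simp [hd.self, hd.adj_symm _ _ h]
  · obtain ⟨z, -, hz, hw⟩ := hd.exists_next x y hxy
    by_cases hwz : w = z
    · subst hwz; omega
    · have := hw w h hwz; omega

/-- If stepping from `w'` to `w` leads away from `z` and towards `y`, then `w` lies between. -/
lemma dist_add_dist (hd : IsTreeDist d) {y z w w' : V} (hadj : d w w' = 1)
    (hz : d w z = d w' z + 1) (hy : d w' y = d w y + 1) : d y z = d y w + d w z := by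
  induction hn : d w' z generalizing w w' with
  | zero =>
    obtain rfl := (hd.eq_zero_iff _ _).1 hn
    rw [hd.symm y w', hy, hd.symm w y]; omega
  | succ n ih =>
    obtain ⟨w'', h1, h2, -⟩ := hd.exists_next w' z (by rintro rfl; simp [hd.self] at hn)
    have hne : w'' ≠ w := by rintro rfl; omega
    obtain ⟨u, -, hu, hu'⟩ := hd.exists_next w' y (by rintro rfl; simp [hd.self] at hy)
    have hwu : w = u := by
      by_contra h
      have := hu' w (hd.adj_symm _ _ hadj) h
      omega
    have h3 := hu' w'' h1 (hwu ▸ hne)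
    have := ih h1 (by omega) h3 (by omega)
    rw [this, hz, hd.symm y w', hd.symm y w, hy]; omega

lemma four_point (hd : IsTreeDist d) (x y z w : V) :
    d x y + d z w ≤ max (d x z + d y w) (d x w + d y z) := by
  induction hn : d w z generalizing w with
  | zero =>
    obtain rfl := (hd.eq_zero_iff _ _).1 hn
    have := hd.triangle x w y
    have := hd.symm w y
    simp only [hd.self]; omega
  | succ n ih =>
    obtain ⟨w', h1, h2, -⟩ := hd.exists_next w z (by rintro rfl; simp [hd.self] at hn)
    have hs := hd.symm
    have := ih w' (by omega)
    rw [hs z w, hs y w, hs x w]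
    rw [hs z w', hs y w', hs x w'] at this
    by_cases hy : d w' y = d w y + 1
    · have := hd.dist_add_dist h1 h2.symm hy
      have := hd.triangle x w y
      have := hs x w
      have := hs y w
      omega
    by_cases hx : d w' x = d w x + 1
    · have := hd.dist_add_dist h1 h2.symm hx
      have := hd.triangle x w y
      have := hs x w
      have := hs y w
      omega
    have := hd.adj_dist h1 x
    have := hd.adj_dist h1 y
    omega

lemma dist_add_dist_add_dist (hd : IsTreeDist d) {a b c e : V} (h₁ : d a b + d b c = d a c)
    (h₂ : d b c + d c e = d b e) (h : 0 < d b c) : d a e = d a b + d b c + d c e := by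
  have := hd.four_point a c b e
  have := hd.symm c b
  have := hd.triangle a c e
  omega

section Action

variable {Γ : Type*} [Group Γ] [MulAction Γ V]

lemma smul_eq_of_between (hd : IsTreeDist d) (hinv : ∀ (g : Γ) (x y : V), d (g • x) (g • y) = d x y)
    {g : Γ} {x y z : V} (hx : g • x = x) (hy : g • y = y) (hz : d x z + d z y = d x y) :
    g • z = z := by
  have h := hd.four_point z (g • z) x y
  have h1 : d (g • z) y = d z y := by simpa [hy] using hinv g z y
  have h2 : d (g • z) x = d z x := by simpa [hx] using hinv g z x
  have h3 := hd.symm x z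
  exact ((hd.eq_zero_iff _ _).1 (by omega)).symm

/-- An isometric involution that inverts no edge fixes a vertex. -/
lemma exists_fixed_of_sq (hd : IsTreeDist d) (hinv : ∀ (g : Γ) (x y : V), d (g • x) (g • y) = d x y)
    {g : Γ} (hg : g * g = 1) (hne : ∀ x : V, d x (g • x) ≠ 1) (x₀ : V) : ∃ x : V, g • x = x := by
  induction hn : d x₀ (g • x₀) using Nat.strong_induction_on generalizing x₀ with
  | _ n ih =>
    by_cases h : x₀ = g • x₀
    · exact ⟨x₀, h.symm⟩
    obtain ⟨y, h1, h2, -⟩ := hd.exists_next x₀ (g • x₀) h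
    have hgg : g • g • x₀ = x₀ := by rw [smul_smul, hg, one_smul]
    have hn1 := hne x₀
    have hne' : g • x₀ ≠ y := by
      intro h'
      rw [h'] at hn1
      exact hn1 h1
    have h3 : d (g • x₀) (g • y) = 1 := by rw [hinv, h1]
    have h4 : d (g • y) x₀ + 1 = d x₀ (g • x₀) := by
      have := hinv g y (g • x₀)
      rw [hgg] at this
      omega
    obtain ⟨z, hz1, hz2, hz3⟩ := hd.exists_next (g • x₀) y hne'
    have hzy : g • y = z := by
      by_contra hc
      have h5 := hz3 _ h3 hc
      have h6 := hd.triangle z y x₀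
      have := hd.symm x₀ (g • x₀)
      have := hd.symm y (g • x₀)
      have h9 := hd.adj_symm _ _ h1
      obtain ⟨u, -, hu2, hu3⟩ := hd.exists_next (g • x₀) x₀ (Ne.symm h)
      have e1 : g • y = u := by
        by_contra hc'
        have := hu3 _ h3 hc'
        omega
      have e2 : z = u := by
        by_contra hc'
        have := hu3 _ hz1 hc'
        omega
      exact hc (e1.trans e2.symm)
    have := hd.symm y (g • y)
    have := hd.symm y (g • x₀)
    refine ih _ ?_ y rfl
    subst hzy
    omega

/-- Reflecting `x` in a fixed point `y` nearest to `x` doubles the distance. -/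
lemma dist_smul_eq_two_mul (hd : IsTreeDist d)
    (hinv : ∀ (g : Γ) (x y : V), d (g • x) (g • y) = d x y)
    {s : Γ} {x y : V} (hy : s • y = y) (hmin : ∀ z, s • z = z → d x y ≤ d x z) :
    d x (s • x) = 2 * d x y := by
  by_cases hxy : y = x
  · subst hxy; simp [hy, hd.self]
  obtain ⟨z, h1, h2, h3⟩ := hd.exists_next y x hxy
  have hs : s • z ≠ z := by
    intro h
    have := hmin z h
    have := hd.symm x y
    have := hd.symm x z
    omega
  have h4 : d y (s • z) = 1 := by simpa [hy, h1] using hinv s y z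
  have h5 : d (s • z) (s • x) = d z x := hinv s z x
  have h6 : d y (s • x) = d y x := by simpa [hy] using hinv s y x
  have := hd.dist_add_dist (y := x) (z := s • x) h4 (by omega) (h3 _ h4 hs)
  have := hd.symm x y
  omega

/-- Two involutions without common fixed points generate a translation. -/
lemma dist_mul_pow_smul (hd : IsTreeDist d) (hinv : ∀ (g : Γ) (x y : V), d (g • x) (g • y) = d x y)
    {r s : Γ} {x y : V} (hr : r • x = x) (hs : s • y = y)
    (hmin : ∀ x' y', r • x' = x' → s • y' = y' → d x y ≤ d x' y') (hpos : 0 < d x y) (k : ℕ) :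
    d x ((r * s) ^ k • x) = 2 * d x y * k := by
  have hxs : d x (s • x) = 2 * d x y :=
    hd.dist_smul_eq_two_mul hinv hs fun z hz => hmin x z hr hz
  have hyr : d y (r • y) = 2 * d x y := by
    rw [hd.symm x y]
    refine hd.dist_smul_eq_two_mul hinv hr fun z hz => ?_
    rw [hd.symm y x, hd.symm y z]
    exact hmin z y hz hs
  have e1 : d x (r • y) = d x y := by simpa [hr] using hinv r x y
  have e2 : d (r • y) ((r * s) • x) = d x y := by
    have := hinv s y x
    rw [mul_smul, hinv, hd.symm x y, ← this, hs]
  have e3 : d x ((r * s) • x) = 2 * d x y := by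
    rw [mul_smul, ← hxs]
    simpa [hr] using hinv r x (s • x)
  have e4 : d (r • y) ((r * s) • r • y) = 2 * d x y := by
    rw [mul_smul, hinv, ← hyr]
    simpa [hs] using hinv s y (r • y)
  have key : d x ((r * s) ^ k • x) = 2 * d x y * k ∧
      d x ((r * s) ^ k • r • y) = 2 * d x y * k + d x y := by
    induction k with
    | zero => simp [hd.self, e1]
    | succ k ih =>
      obtain ⟨i1, i2⟩ := ih
      set τ := r * s
      have a1 : d (τ ^ k • x) (τ ^ k • r • y) = d x y := by rw [hinv, e1]
      have a2 : d (τ ^ k • r • y) (τ ^ (k + 1) • x) = d x y := by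
        rw [pow_succ, mul_smul, hinv, e2]
      have a3 : d (τ ^ k • x) (τ ^ (k + 1) • x) = 2 * d x y := by
        rw [pow_succ, mul_smul, hinv, e3]
      have a4 : d (τ ^ k • r • y) (τ ^ (k + 1) • r • y) = 2 * d x y := by
        rw [pow_succ, mul_smul, hinv, e4]
      have a5 : d (τ ^ (k + 1) • x) (τ ^ (k + 1) • r • y) = d x y := by rw [hinv, e1]
      have b1 := hd.dist_add_dist_add_dist (a := x) (b := τ ^ k • x) (c := τ ^ k • r • y)
        (e := τ ^ (k + 1) • x) (by omega) (by omega) (by omega)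
      have b2 := hd.dist_add_dist_add_dist (a := x) (b := τ ^ k • r • y) (c := τ ^ (k + 1) • x)
        (e := τ ^ (k + 1) • r • y) (by omega) (by omega) (by omega)
      rw [mul_add_one]
      omega
  exact key.1

end Action

end IsTreeDist

/-- The elements commuting with some nontrivial power of `h`. -/
def powCentralizer {Γ : Type*} [Group Γ] (h : Γ) : Subgroup Γ where
  carrier := {g | ∃ n : ℕ, 0 < n ∧ Commute g (h ^ n)}
  one_mem' := ⟨1, one_pos, Commute.one_left _⟩
  mul_mem' := by
    rintro a b ⟨n, hn, ha⟩ ⟨m, hm, hb⟩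
    refine ⟨n * m, by positivity, Commute.mul_left ?_ ?_⟩
    · rw [pow_mul]; exact ha.pow_right m
    · rw [mul_comm, pow_mul]; exact hb.pow_right n
  inv_mem' := by
    rintro a ⟨n, hn, ha⟩
    exact ⟨n, hn, ha.inv_left⟩

namespace IsTreeDist

variable {V : Type*} {d : V → V → ℕ} {Γ : Type*} [Group Γ] [MulAction Γ V]

/-- `h` translates the point `x` along an axis, by the amount `ℓ`. -/
structure Translates (d : V → V → ℕ) (h : Γ) (x : V) (ℓ : ℕ) : Prop where
  pos : 0 < ℓ
  dist_pow : ∀ k : ℕ, d x (h ^ k • x) = ℓ * k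

/-- `c` is the value at `g` of the Busemann character of the translation `h`. -/
def IsBusemann (d : V → V → ℕ) (h : Γ) (x : V) (ℓ : ℕ) (g : Γ) (c : ℤ) : Prop :=
  ∃ K : ℕ, ∀ k ≥ K, (d (g • x) (h ^ k • x) : ℤ) = ℓ * k - c

lemma Translates.dist_zpow (hd : IsTreeDist d)
    (hinv : ∀ (g : Γ) (x y : V), d (g • x) (g • y) = d x y) {h : Γ} {x : V} {ℓ : ℕ}
    (ht : Translates d h x ℓ) (i j : ℤ) :
    d (h ^ i • x) (h ^ j • x) = ℓ * (i - j).natAbs := by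
  wlog hij : i ≤ j generalizing i j
  · rw [hd.symm, this j i (by omega), ← Int.natAbs_neg, neg_sub]
  obtain ⟨k, hk⟩ := Int.eq_ofNat_of_zero_le (show 0 ≤ j - i by omega)
  have : h ^ j = h ^ i * h ^ k := by rw [← zpow_natCast, ← zpow_add]; congr 1; omega
  rw [this, mul_smul, hinv, ht.dist_pow]
  congr 1; omega

lemma Translates.not_isOfFinOrder (hd : IsTreeDist d) {h : Γ} {x : V} {ℓ : ℕ}
    (ht : Translates d h x ℓ) : ¬ IsOfFinOrder h := by
  rw [isOfFinOrder_iff_pow_eq_one]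
  rintro ⟨n, hn, h1⟩
  have := ht.dist_pow n
  rw [h1, one_smul, hd.self] at this
  have := Nat.mul_pos ht.pos hn
  omega

lemma Translates.exists_isBusemann (hd : IsTreeDist d)
    (hinv : ∀ (g : Γ) (x y : V), d (g • x) (g • y) = d x y) {h : Γ} {x : V} {ℓ : ℕ}
    (ht : Translates d h x ℓ) (g : Γ) : ∃ c, IsBusemann d h x ℓ g c := by
  set a : ℕ → ℕ := fun k => d (g • x) (h ^ k • x) + d (g • x) x - ℓ * k with ha
  have hle : ∀ k, ℓ * k ≤ d (g • x) (h ^ k • x) + d (g • x) x := fun k => by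
    have := hd.triangle x (g • x) (h ^ k • x)
    rw [ht.dist_pow, hd.symm x] at this
    omega
  have hanti : ∀ k, a (k + 1) ≤ a k := fun k => by
    have h1 := hd.triangle (g • x) (h ^ k • x) (h ^ (k + 1) • x)
    have h2 : d (h ^ k • x) (h ^ (k + 1) • x) = ℓ := by
      rw [pow_succ, mul_smul, hinv]
      simpa using ht.dist_pow 1
    have h3 : ℓ * (k + 1) = ℓ * k + ℓ := by ring
    simp only [ha]
    omega
  have hanti' : Antitone a := antitone_nat_of_succ_le hanti
  obtain ⟨K, hK⟩ : ∃ K, ∀ k, a K ≤ a k := by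
    obtain ⟨_, ⟨K, rfl⟩, hK⟩ := WellFounded.has_min (wellFounded_lt (α := ℕ)) (Set.range a)
      ⟨_, Set.mem_range_self 0⟩
    exact ⟨K, fun k => not_lt.1 (hK _ (Set.mem_range_self k))⟩
  refine ⟨(d (g • x) x : ℤ) - a K, K, fun k hk => ?_⟩
  have h1 : a k = a K := le_antisymm (hanti' hk) (hK k)
  have h2 := hle k
  have h3 : a k + ℓ * k = d (g • x) (h ^ k • x) + d (g • x) x := by simp only [ha]; omega
  zify at h3 h1
  linarith

lemma IsBusemann.unique {h : Γ} {x : V} {ℓ : ℕ} {g : Γ} {c c' : ℤ}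
    (hc : IsBusemann d h x ℓ g c) (hc' : IsBusemann d h x ℓ g c') : c = c' := by
  obtain ⟨K, hK⟩ := hc
  obtain ⟨K', hK'⟩ := hc'
  have h1 := hK (max K K') (le_max_left _ _)
  have h2 := hK' (max K K') (le_max_right _ _)
  linarith

lemma Translates.isBusemann_mul (hd : IsTreeDist d)
    (hinv : ∀ (g : Γ) (x y : V), d (g • x) (g • y) = d x y) {h : Γ} {x : V} {ℓ : ℕ}
    (ht : Translates d h x ℓ) {g g' : Γ} {c c' : ℤ} (hg : g ∈ powCentralizer h)
    (hc : IsBusemann d h x ℓ g c) (hc' : IsBusemann d h x ℓ g' c') :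
    IsBusemann d h x ℓ (g * g') (c + c') := by
  obtain ⟨e, he⟩ := ht.exists_isBusemann hd hinv (g * g')
  suffices e = c + c' by rwa [← this]
  obtain ⟨n, hn, hcomm⟩ := hg
  obtain ⟨K, hK⟩ := hc
  obtain ⟨K', hK'⟩ := hc'
  obtain ⟨K'', hK''⟩ := he
  set k := K + K' + K'' + d (g' • x) x + d x (g • x) + e.natAbs + c.natAbs + c'.natAbs + 1 with hk
  have hnk : k ≤ n * k := Nat.le_mul_of_pos_left k hn
  have h1 := hK (n * k) (by omega)
  have h2 := hK' (n * k) (by omega)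
  have h3 := hK'' (n * k) (by omega)
  set X := h ^ (n * k) • x with hX
  have hgX : g • X = h ^ (n * k) • g • x := by
    rw [hX, smul_smul, smul_smul, pow_mul, (hcomm.pow_right k).eq]
  have f1 : d ((g * g') • x) (g • x) = d (g' • x) x := by rw [mul_smul, hinv]
  have f2 : d X (g • X) = d x (g • x) := by rw [hgX, hX, hinv]
  have f3 : d (g • x) (g • X) = ℓ * (n * k) := by rw [hinv, ht.dist_pow]
  have f4 : d ((g * g') • x) (g • X) = d (g' • x) X := by rw [mul_smul, hinv]
  have hl : n * k ≤ ℓ * (n * k) := Nat.le_mul_of_pos_left _ ht.pos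
  have p1 := hd.four_point ((g * g') • x) X (g • x) (g • X)
  have p2 := hd.four_point ((g * g') • x) (g • X) (g • x) X
  have := hd.symm X (g • x)
  have := hd.symm X (g • X)
  have := hd.symm (g • X) (g • x)
  push_cast at h1 h2 h3
  zify at hl f3
  generalize (ℓ : ℤ) * ((n : ℤ) * (k : ℤ)) = D at *
  omega

lemma Translates.fixes_of_isBusemann_zero (hd : IsTreeDist d)
    (hinv : ∀ (g : Γ) (x y : V), d (g • x) (g • y) = d x y) {h : Γ} {x : V} {ℓ : ℕ}
    (ht : Translates d h x ℓ) {g : Γ} (hg : g ∈ powCentralizer h)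
    (hc : IsBusemann d h x ℓ g 0) (j : ℤ) : g • h ^ j • x = h ^ j • x := by
  obtain ⟨n, hn, hcomm⟩ := hg
  have hcz : ∀ i : ℤ, Commute g (h ^ (n * i)) := fun i => by
    rw [zpow_mul, zpow_natCast]; exact hcomm.zpow_right i
  have hgz : ∀ i : ℤ, g • h ^ (n * i) • x = h ^ (n * i) • g • x := fun i => by
    rw [smul_smul, smul_smul, (hcz i).eq]
  have hgx : g • x = x := by
    obtain ⟨K, hK⟩ := hc
    set k := K + d x (g • x) + 1 with hk
    have hnk : k ≤ n * k := Nat.le_mul_of_pos_left k hn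
    have hl : n * k ≤ ℓ * (n * k) := Nat.le_mul_of_pos_left _ ht.pos
    have h1 := hK (n * k) (by omega)
    set X := h ^ (n * k) • x with hX
    have hXz : X = h ^ ((n : ℤ) * k) • x := by rw [hX, ← zpow_natCast]; push_cast; rfl
    set X' := h ^ ((n : ℤ) * -k) • x with hX'
    have f1 : d x X = ℓ * (n * k) := ht.dist_pow _
    have f2 : d (g • x) (g • X) = ℓ * (n * k) := by rw [hinv, f1]
    have f3 : d X (g • X) = d x (g • x) := by rw [hXz, hgz, hinv]
    have f4 : d x (g • X) = d X' (g • x) := by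
      have hx : h ^ ((n : ℤ) * k) • X' = x := by
        rw [hX', smul_smul, ← zpow_add, mul_neg, add_neg_cancel, zpow_zero, one_smul]
      have hgX : g • X = h ^ ((n : ℤ) * k) • g • x := by rw [hXz, hgz]
      rw [hgX, ← hinv (h ^ ((n : ℤ) * k)) X', hx]
    have f5 : d x X' = ℓ * (n * k) := by
      have := ht.dist_zpow hd hinv 0 (n * -k)
      rw [zpow_zero, one_smul] at this
      rw [hX', this]
      congr 1
      rw [zero_sub, mul_neg, neg_neg]
      exact_mod_cast Int.natAbs_natCast (n * k)
    have f6 : d X X' = 2 * (ℓ * (n * k)) := by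
      rw [hXz, hX', ht.dist_zpow hd hinv]
      have : ((n : ℤ) * k - n * -k) = ((2 * (n * k) : ℕ) : ℤ) := by push_cast; ring
      rw [this, Int.natAbs_natCast]; ring
    have p1 := hd.four_point x X (g • x) (g • X)
    have p2 := hd.four_point x (g • X) (g • x) X
    have p3 := hd.four_point x (g • x) X X'
    have s1 := hd.symm X (g • x)
    have s2 := hd.symm X' (g • x)
    have s3 := hd.symm X (g • X)
    have s4 := hd.symm (g • X) (g • x)
    push_cast at h1
    zify at hl f1 f2 f5 f6
    generalize (ℓ : ℤ) * ((n : ℤ) * (k : ℤ)) = D at *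
    exact ((hd.eq_zero_iff _ _).1 (by omega)).symm
  have hfix : ∀ i : ℤ, g • h ^ (n * i) • x = h ^ (n * i) • x := fun i => by rw [hgz, hgx]
  refine hd.smul_eq_of_between hinv (hfix (-|j|)) (hfix |j|) ?_
  simp only [ht.dist_zpow hd hinv, ← mul_add]
  congr 1
  have : |j| ≤ n * |j| := le_mul_of_one_le_left (abs_nonneg _) (by omega)
  rw [mul_neg]
  have := neg_abs_le j
  have := le_abs_self j
  omega

/-- The Busemann character: the centralizer of powers of a translation acts on its axis
by translations. -/
lemma Translates.exists_busemannHom (hd : IsTreeDist d)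
    (hinv : ∀ (g : Γ) (x y : V), d (g • x) (g • y) = d x y) {h : Γ} {x : V} {ℓ : ℕ}
    (ht : Translates d h x ℓ) : ∃ β : powCentralizer h →* Multiplicative ℤ,
      ∀ g, β g = 1 → ∀ j : ℤ, (g : Γ) • h ^ j • x = h ^ j • x := by
  choose b hb using ht.exists_isBusemann hd hinv
  refine ⟨MonoidHom.mk' (fun g => Multiplicative.ofAdd (b g)) fun g g' => ?_, fun g hg => ?_⟩
  · rw [← ofAdd_add]
    exact congrArg _ ((hb _).unique (ht.isBusemann_mul hd hinv g.2 (hb g) (hb g')))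
  · refine ht.fixes_of_isBusemann_zero hd hinv g.2 ?_
    have : b g = 0 := hg
    exact this ▸ hb g

lemma Translates.natAbs_eq_of_conj (hd : IsTreeDist d)
    (hinv : ∀ (g : Γ) (x y : V), d (g • x) (g • y) = d x y) {h : Γ} {x : V} {ℓ : ℕ}
    (ht : Translates d h x ℓ) {g : Γ} {a b : ℤ} (hg : g * h ^ a * g⁻¹ = h ^ b) :
    a.natAbs = b.natAbs := by
  set e := d (g • x) x with he
  have key : ∀ k : ℕ, ℓ * (a.natAbs * k) ≤ ℓ * (b.natAbs * k) + 2 * e ∧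
      ℓ * (b.natAbs * k) ≤ ℓ * (a.natAbs * k) + 2 * e := fun k => by
    have h1 : g * h ^ (a * k) = h ^ (b * k) * g := by
      rw [zpow_mul, zpow_mul, ← hg, zpow_natCast, zpow_natCast, conj_pow]; group
    have f1 : d x (h ^ (a * k) • x) = ℓ * (a.natAbs * k) := by
      have := ht.dist_zpow hd hinv 0 (a * k)
      rwa [zpow_zero, one_smul, zero_sub, Int.natAbs_neg, Int.natAbs_mul,
        Int.natAbs_natCast] at this
    have f2 : d x (h ^ (b * k) • x) = ℓ * (b.natAbs * k) := by
      have := ht.dist_zpow hd hinv 0 (b * k)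
      rwa [zpow_zero, one_smul, zero_sub, Int.natAbs_neg, Int.natAbs_mul,
        Int.natAbs_natCast] at this
    have f3 : d (g • x) (h ^ (b * k) • g • x) = ℓ * (a.natAbs * k) := by
      rw [smul_smul, ← h1, mul_smul, hinv, f1]
    have f4 : d (h ^ (b * k) • g • x) (h ^ (b * k) • x) = e := by rw [hinv]
    have t1 := hd.triangle (g • x) x (h ^ (b * k) • g • x)
    have t2 := hd.triangle x (h ^ (b * k) • x) (h ^ (b * k) • g • x)
    have t3 := hd.triangle x (g • x) (h ^ (b * k) • x)
    have t4 := hd.triangle (g • x) (h ^ (b * k) • g • x) (h ^ (b * k) • x)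
    have s1 := hd.symm x (g • x)
    have s2 := hd.symm (h ^ (b * k) • x) (h ^ (b * k) • g • x)
    omega
  obtain ⟨k1, k2⟩ := key (2 * e + 1)
  have hpos := ht.pos
  by_contra hne
  rcases Nat.lt_or_gt_of_ne hne with hlt | hlt
  · have : ℓ * (a.natAbs * (2 * e + 1)) + (2 * e + 1) ≤ ℓ * (b.natAbs * (2 * e + 1)) := by
      nlinarith [Nat.mul_le_mul_right (2 * e + 1) hlt, Nat.mul_le_mul_left ℓ
        (Nat.mul_le_mul_right (2 * e + 1) hlt), Nat.mul_le_mul_right (2 * e + 1) hpos]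
    omega
  · have : ℓ * (b.natAbs * (2 * e + 1)) + (2 * e + 1) ≤ ℓ * (a.natAbs * (2 * e + 1)) := by
      nlinarith [Nat.mul_le_mul_right (2 * e + 1) hlt, Nat.mul_le_mul_left ℓ
        (Nat.mul_le_mul_right (2 * e + 1) hlt), Nat.mul_le_mul_right (2 * e + 1) hpos]
    omega

end IsTreeDist

section Involutions

variable {G H : Type*} [Group G] [Group H]

lemma isInvol_iff {r : G} : IsInvol r ↔ r * r = 1 ∧ r ≠ 1 := by
  rw [IsInvol, orderOf_eq_iff two_pos, pow_two]
  refine and_congr_right fun _ => ⟨fun h => ?_, fun h m hm hm' => ?_⟩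
  · simpa using h 1 one_lt_two one_pos
  · obtain rfl : m = 1 := by omega
    simpa using h

lemma IsInvol.mul_self {r : G} (h : IsInvol r) : r * r = 1 := (isInvol_iff.1 h).1

lemma IsInvol.ne_one {r : G} (h : IsInvol r) : r ≠ 1 := (isInvol_iff.1 h).2

lemma IsInvol.inv_eq {r : G} (h : IsInvol r) : r⁻¹ = r := inv_eq_of_mul_eq_one_left h.mul_self

lemma IsInvol.map_iff {f : G →* H} (hf : Function.Injective f) {r : G} :
    IsInvol (f r) ↔ IsInvol r := by
  rw [IsInvol, IsInvol, orderOf_injective f hf]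

lemma conj_left_injective (g : G) : Function.Injective (fun x : G => g * x * g⁻¹) := fun x y h => by
  simpa using h

lemma IsInvol.conj {r : G} (h : IsInvol r) (g : G) : IsInvol (g * r * g⁻¹) :=
  (IsInvol.map_iff (f := (MulAut.conj g).toMonoidHom) (MulAut.conj g).injective).2 h

/-- Distinct involutions have a product of infinite order. -/
def InvolFree (G : Type*) [Group G] : Prop :=
  ∀ r s : G, IsInvol r → IsInvol s → r ≠ s → ¬ IsOfFinOrder (r * s)

/-- Two pairs of elements are simultaneously conjugate. -/
def PairConj (r s r' s' : G) : Prop := ∃ g : G, g * r * g⁻¹ = r' ∧ g * s * g⁻¹ = s'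

lemma PairConj.symm {r s r' s' : G} : PairConj r s r' s' → PairConj r' s' r s := by
  rintro ⟨g, rfl, rfl⟩
  exact ⟨g⁻¹, by group, by group⟩

lemma PairConj.trans {r s r' s' r'' s'' : G} :
    PairConj r s r' s' → PairConj r' s' r'' s'' → PairConj r s r'' s'' := by
  rintro ⟨g, rfl, rfl⟩ ⟨h, rfl, rfl⟩
  exact ⟨h * g, by group, by group⟩

lemma PairConj.map (f : G →* H) {r s r' s' : G} :
    PairConj r s r' s' → PairConj (f r) (f s) (f r') (f s') := by
  rintro ⟨g, rfl, rfl⟩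
  exact ⟨f g, by simp, by simp⟩

/-- A nontrivial power of a product of two distinct involutions. -/
def IsTranslationPow (p : G) : Prop :=
  ∃ r s : G, ∃ n : ℤ, IsInvol r ∧ IsInvol s ∧ r ≠ s ∧ n ≠ 0 ∧ p = (r * s) ^ n

lemma IsTranslationPow.conj {p : G} (h : IsTranslationPow p) (g : G) :
    IsTranslationPow (g⁻¹ * p * g) := by
  obtain ⟨r, s, n, hr, hs, hrs, hn, rfl⟩ := h
  refine ⟨g⁻¹ * r * g⁻¹⁻¹, g⁻¹ * s * g⁻¹⁻¹, n, hr.conj _, hs.conj _,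
    (conj_left_injective g⁻¹).ne hrs, hn, ?_⟩
  rw [show g⁻¹ * r * g⁻¹⁻¹ * (g⁻¹ * s * g⁻¹⁻¹) = g⁻¹ * (r * s) * g⁻¹⁻¹ by group, conj_zpow, inv_inv]

lemma zpow_ne_one_of_not_isOfFinOrder {h : G} (hh : ¬ IsOfFinOrder h) {n : ℤ} (hn : n ≠ 0) :
    h ^ n ≠ 1 := fun h1 => hh (isOfFinOrder_iff_zpow_eq_one.2 ⟨n, hn, h1⟩)

lemma IsTranslationPow.not_isOfFinOrder (ha : InvolFree G) {p : G} (h : IsTranslationPow p) :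
    ¬ IsOfFinOrder p := by
  obtain ⟨r, s, n, hr, hs, hrs, hn, rfl⟩ := h
  rw [isOfFinOrder_iff_zpow_eq_one]
  rintro ⟨m, hm, h1⟩
  rw [← zpow_mul] at h1
  exact zpow_ne_one_of_not_isOfFinOrder (ha r s hr hs hrs) (mul_ne_zero hn hm) h1

/-- The commensurator of `⟨h⟩`: the elements conjugating a nontrivial power of `h` to one. -/
def powNormalizer (h : G) : Subgroup G where
  carrier := {x | ∃ m n : ℤ, m ≠ 0 ∧ n ≠ 0 ∧ x * h ^ m * x⁻¹ = h ^ n}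
  one_mem' := ⟨1, 1, one_ne_zero, one_ne_zero, by simp⟩
  mul_mem' := by
    rintro a b ⟨m, n, hm, hn, h1⟩ ⟨m', n', hm', hn', h2⟩
    refine ⟨m' * m, n * n', mul_ne_zero hm' hm, mul_ne_zero hn hn', ?_⟩
    calc a * b * h ^ (m' * m) * (a * b)⁻¹ = a * (b * h ^ m' * b⁻¹) ^ m * a⁻¹ := by
          rw [conj_zpow, zpow_mul]; group
      _ = (a * h ^ m * a⁻¹) ^ n' := by
          rw [h2, conj_zpow, ← zpow_mul, ← zpow_mul, mul_comm]
      _ = h ^ (n * n') := by rw [h1, zpow_mul]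
  inv_mem' := by
    rintro a ⟨m, n, hm, hn, h1⟩
    exact ⟨n, m, hn, hm, by rw [← h1]; group⟩

lemma mem_powNormalizer {h x : G} :
    x ∈ powNormalizer h ↔ ∃ m n : ℤ, m ≠ 0 ∧ n ≠ 0 ∧ x * h ^ m * x⁻¹ = h ^ n := Iff.rfl

lemma mul_zpow_mul_of_isInvol {r s : G} (hr : IsInvol r) (hs : IsInvol s) (n : ℤ) :
    r * (r * s) ^ n * r = (r * s) ^ (-n) := by
  have h : r * (r * s) * r⁻¹ = (r * s)⁻¹ := by
    rw [mul_inv_rev, hs.inv_eq, hr.inv_eq, ← mul_assoc r r s, hr.mul_self, one_mul]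
  rw [zpow_neg, ← inv_zpow, ← h, conj_zpow, hr.inv_eq]

lemma mul_zpow_mul_of_isInvol' {r s : G} (hr : IsInvol r) (hs : IsInvol s) (n : ℤ) :
    s * (r * s) ^ n * s = (r * s) ^ (-n) := by
  have h : s * (r * s) * s⁻¹ = (r * s)⁻¹ := by
    rw [mul_inv_rev, hs.inv_eq, hr.inv_eq, mul_assoc, mul_assoc, hs.mul_self, mul_one]
  rw [zpow_neg, ← inv_zpow, ← h, conj_zpow, hs.inv_eq]

lemma left_mem_powNormalizer {r s : G} (hr : IsInvol r) (hs : IsInvol s) :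
    r ∈ powNormalizer (r * s) :=
  ⟨1, -1, one_ne_zero, by decide, by rw [hr.inv_eq, mul_zpow_mul_of_isInvol hr hs]⟩

lemma right_mem_powNormalizer {r s : G} (hr : IsInvol r) (hs : IsInvol s) :
    s ∈ powNormalizer (r * s) :=
  ⟨1, -1, one_ne_zero, by decide, by rw [hs.inv_eq, mul_zpow_mul_of_isInvol' hr hs]⟩

lemma self_mem_powNormalizer (h : G) : h ∈ powNormalizer h :=
  ⟨1, 1, one_ne_zero, one_ne_zero, by group⟩

lemma powCentralizer_le_powNormalizer (h : G) : powCentralizer h ≤ powNormalizer h := by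
  rintro x ⟨n, hn, hx⟩
  refine ⟨n, n, by omega, by omega, ?_⟩
  rw [zpow_natCast, hx.eq, mul_inv_cancel_right]

lemma powNormalizer_conj (g h : G) :
    powNormalizer (g * h * g⁻¹) = (powNormalizer h).map (MulAut.conj g).toMonoidHom := by
  ext x
  simp only [Subgroup.mem_map, mem_powNormalizer, conj_zpow, MulEquiv.toMonoidHom_eq_coe,
    MonoidHom.coe_coe, MulAut.conj_apply]
  constructor
  · rintro ⟨m, n, hm, hn, h1⟩
    refine ⟨g⁻¹ * x * g, ⟨m, n, hm, hn, ?_⟩, by group⟩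
    have h2 : h ^ n = g⁻¹ * (g * h ^ n * g⁻¹) * g := by group
    rw [h2, ← h1]; group
  · rintro ⟨y, ⟨m, n, hm, hn, h1⟩, rfl⟩
    refine ⟨m, n, hm, hn, ?_⟩
    rw [← h1]; group

end Involutions

section Dihedral

variable {G H : Type*} [Group G] [Group H]

/-- The homomorphism from the infinite dihedral group determined by an element `c` inverted by
an involution `u`. -/
def dihedralHom (u c : G) (hu : u * u = 1) (huc : u * c * u = c⁻¹) : DihedralGroup 0 →* G :=
  have hz : ∀ i : ℤ, c ^ i * u = u * c ^ (-i) := fun i => by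
    have hu' : u⁻¹ = u := inv_eq_of_mul_eq_one_left hu
    have h1 : (u * c * u⁻¹) ^ (-i) = c ^ i := by rw [hu', huc, inv_zpow, zpow_neg, inv_inv]
    rw [← h1, conj_zpow, inv_mul_cancel_right]
  { toFun := fun x => match x with
      | .r i => c ^ (show ℤ from i)
      | .sr i => u * c ^ (show ℤ from i)
    map_one' := zpow_zero c
    map_mul' := by
      rintro (i | i) (j | j)
      · exact zpow_add c _ _
      · change u * c ^ ((show ℤ from j) - (show ℤ from i)) = c ^ (show ℤ from i) * (u * c ^ _)
        rw [← mul_assoc, hz, mul_assoc, ← zpow_add, sub_eq_neg_add]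
      · change u * c ^ ((show ℤ from i) + (show ℤ from j)) = u * c ^ (show ℤ from i) * c ^ _
        rw [zpow_add, mul_assoc]
      · change c ^ ((show ℤ from j) - (show ℤ from i)) =
          u * c ^ (show ℤ from i) * (u * c ^ (show ℤ from j))
        rw [mul_assoc, ← mul_assoc (c ^ _), hz, ← mul_assoc, ← mul_assoc, hu, one_mul,
          ← zpow_add, sub_eq_neg_add] }

variable {u c : G} {hu : u * u = 1} {huc : u * c * u = c⁻¹}

lemma dihedralHom_injective (hu1 : u ≠ 1) (hc : ¬ IsOfFinOrder c) :
    Function.Injective (dihedralHom u c hu huc) := by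
  rw [injective_iff_map_eq_one]
  rintro (i | i) h
  · change c ^ (show ℤ from i) = 1 at h
    by_contra hi
    exact zpow_ne_one_of_not_isOfFinOrder hc (n := i) (fun h0 => hi (congrArg _ h0)) h
  · change u * c ^ (show ℤ from i) = 1 at h
    have h1 : u = c ^ (-(show ℤ from i)) := by
      rw [zpow_neg]; exact eq_inv_of_mul_eq_one_left h
    have h2 : c ^ (2 * (-(show ℤ from i))) = 1 := by
      rw [two_mul, zpow_add, ← h1, hu]
    by_cases hi : -(show ℤ from i) = 0
    · rw [hi, zpow_zero] at h1
      exact absurd h1 hu1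
    · exact absurd h2 (zpow_ne_one_of_not_isOfFinOrder hc (by omega))

/-- The commensurator of `⟨r * s⟩` is infinite dihedral. -/
def IsDihedralPair (r s : G) : Prop :=
  ∃ ψ : DihedralGroup 0 →* G, Function.Injective ψ ∧ ψ.range = powNormalizer (r * s)

lemma IsDihedralPair.map {f : G →* H} (hf : Function.Injective f) {r s : G}
    (h : IsDihedralPair r s) (hE : powNormalizer (f (r * s)) = (powNormalizer (r * s)).map f) :
    IsDihedralPair (f r) (f s) := by
  obtain ⟨ψ, hψ, hr⟩ := h
  exact ⟨f.comp ψ, hf.comp hψ, by rw [← map_mul, hE, ← hr, MonoidHom.range_comp]⟩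

lemma IsDihedralPair.of_pairConj {r s r' s' : G} (h : IsDihedralPair r s)
    (hc : PairConj r s r' s') : IsDihedralPair r' s' := by
  obtain ⟨g, rfl, rfl⟩ := hc
  refine h.map (f := (MulAut.conj g).toMonoidHom) (MulAut.conj g).injective ?_
  exact powNormalizer_conj _ _

/-- A translation whose commensurator acts faithfully on an axis has dihedral commensurator. -/
lemma isDihedralPair_of_injective {r s : G} (hr : IsInvol r) (hs : IsInvol s)
    (hτ : ¬ IsOfFinOrder (r * s))
    (β : powCentralizer (r * s) →* Multiplicative ℤ) (hβ : Function.Injective β)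
    (hab : ∀ (x : G) (a b : ℤ), x * (r * s) ^ a * x⁻¹ = (r * s) ^ b → a.natAbs = b.natAbs) :
    IsDihedralPair r s := by
  have hcyc : IsCyclic (powCentralizer (r * s)) := isCyclic_of_injective β hβ
  obtain ⟨⟨c, hcP⟩, hgen⟩ := hcyc.exists_generator
  have hP : ∀ x ∈ powCentralizer (r * s), ∃ i : ℤ, c ^ i = x := fun x hx => by
    obtain ⟨i, hi⟩ := Subgroup.mem_zpowers_iff.1 (hgen ⟨x, hx⟩)
    exact ⟨i, congrArg Subtype.val hi⟩
  obtain ⟨m, hm⟩ := hP (r * s) ⟨1, one_pos, Commute.pow_self _ _ |>.symm⟩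
  have hc : ¬ IsOfFinOrder c := fun h => hτ (hm ▸ h.zpow)
  have hm0 : m ≠ 0 := by
    rintro rfl
    exact hτ (by rw [← hm, zpow_zero]; exact IsOfFinOrder.one)
  have hrcr : r * c * r = c⁻¹ := by
    have hmem : r * c * r ∈ powCentralizer (r * s) := by
      obtain ⟨n, hn, h⟩ := hcP
      refine ⟨n, hn, ?_⟩
      have h1 : (r * s) ^ n = r * (r * s) ^ (-n : ℤ) * r := by
        rw [mul_zpow_mul_of_isInvol hr hs, neg_neg, zpow_natCast]
      have h2 : Commute c ((r * s) ^ (-n : ℤ)) := by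
        rw [zpow_neg, zpow_natCast]; exact h.inv_right
      have h3 := (Commute.conj_iff r).2 h2
      rwa [hr.inv_eq, ← h1] at h3
    obtain ⟨e, he⟩ := hP _ hmem
    have h1 : c ^ (e * m) = c ^ (-m) := by
      have h5 := conj_zpow (a := r) (b := c) (i := m)
      have h6 := mul_zpow_mul_of_isInvol hr hs 1
      rw [zpow_one, zpow_neg_one, ← hm] at h6
      rw [hr.inv_eq, h6] at h5
      rw [zpow_mul, he, zpow_neg, h5]
    have h2 : c ^ (e * m + m) = 1 := by rw [zpow_add, h1, zpow_neg, inv_mul_cancel]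
    have h3 : e * m + m = 0 := by
      by_contra h
      exact zpow_ne_one_of_not_isOfFinOrder hc h h2
    have h4 : e = -1 := by
      have : (e + 1) * m = 0 := by linarith
      rcases mul_eq_zero.1 this with h | h
      · omega
      · exact absurd h hm0
    rw [← he, h4, zpow_neg_one]
  refine ⟨dihedralHom r c hr.mul_self hrcr, dihedralHom_injective hr.ne_one hc, ?_⟩
  have hrE := left_mem_powNormalizer hr hs
  have hcE := powCentralizer_le_powNormalizer _ hcP
  ext x
  constructor
  · rintro ⟨i | i, rfl⟩
    · exact zpow_mem hcE _
    · exact mul_mem hrE (zpow_mem hcE _)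
  · intro hx
    have key : ∀ (x : G) (a : ℤ), a ≠ 0 → x * (r * s) ^ a * x⁻¹ = (r * s) ^ a →
        x ∈ powCentralizer (r * s) := fun x a ha h => by
      refine ⟨a.natAbs, by omega, ?_⟩
      have hcm : Commute x ((r * s) ^ a) := mul_inv_eq_iff_eq_mul.1 h
      rcases Int.natAbs_eq a with h' | h'
      · rwa [h', zpow_natCast] at hcm
      · rw [h', zpow_neg, zpow_natCast] at hcm
        exact inv_inv ((r * s) ^ a.natAbs) ▸ hcm.inv_right
    obtain ⟨a, b, ha, hb, hxab⟩ := hx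
    rcases Int.natAbs_eq_natAbs_iff.1 (hab x a b hxab) with rfl | rfl
    · obtain ⟨i, rfl⟩ := hP x (key x a ha hxab)
      exact ⟨.r i, rfl⟩
    · obtain ⟨i, hi⟩ := hP (r * x) (key (r * x) (-b) ha (by
        rw [mul_inv_rev, hr.inv_eq, show r * x * (r * s) ^ (-b) * (x⁻¹ * r) =
          r * (x * (r * s) ^ (-b) * x⁻¹) * r by group, hxab, mul_zpow_mul_of_isInvol hr hs]))
      refine ⟨.sr i, ?_⟩
      change r * c ^ i = x
      rw [hi, ← mul_assoc, hr.mul_self, one_mul]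

lemma mul_self_eq_one_or_of_mem_range {ψ : DihedralGroup 0 →* G} {x : G} (hx : x ∈ ψ.range) :
    x * x = 1 ∨ ∃ i : ℤ, i ≠ 0 ∧ x = ψ (.r 1) ^ i := by
  obtain ⟨i | i, rfl⟩ := hx
  · by_cases hi : i = 0
    · left
      rw [hi, ← map_mul]
      exact map_one ψ
    · right
      refine ⟨i, hi, ?_⟩
      have h1 : ∀ j : ℤ, ψ (.r 1) ^ j = ψ (.r (Int.cast j)) := fun j => by
        rw [← map_zpow, DihedralGroup.r_one_zpow]
      rw [h1 i]
      rfl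
  · left
    rw [← map_mul, DihedralGroup.sr_mul_sr, sub_self]
    exact map_one ψ

lemma isTranslationPow_r_one_zpow {ψ : DihedralGroup 0 →* G} (hψ : Function.Injective ψ) {i : ℤ}
    (hi : i ≠ 0) : IsTranslationPow (ψ (.r 1) ^ i) := by
  have hsr : ∀ j, IsInvol (ψ (.sr j)) := fun j => (IsInvol.map_iff hψ).2 (by
    rw [IsInvol]; exact DihedralGroup.orderOf_sr j)
  refine ⟨ψ (.sr 0), ψ (.sr 1), i, hsr _, hsr _, hψ.ne ?_, hi, ?_⟩
  · intro h
    injection h with h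
    exact absurd (h : (0 : ℤ) = 1) (by decide)
  · rw [← map_mul, DihedralGroup.sr_mul_sr, sub_zero]

lemma eq_zpow_of_mem_range {ψ : DihedralGroup 0 →* G} {x : G} (hx : x ∈ ψ.range)
    (hx' : ¬ IsOfFinOrder x) : ∃ i : ℤ, i ≠ 0 ∧ x = ψ (.r 1) ^ i :=
  (mul_self_eq_one_or_of_mem_range hx).resolve_left fun h =>
    hx' (isOfFinOrder_iff_pow_eq_one.2 ⟨2, two_pos, by rw [pow_two, h]⟩)

end Dihedral

namespace HNNExtension

open NormalWord

variable {G : Type*} [Group G] {A B : Subgroup G} {φ : A ≃* B}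

/-- The normal form of an element, for an arbitrary choice of transversals. -/
noncomputable def normalForm (g : HNNExtension G A B φ) :
    NormalWord (Classical.arbitrary (TransversalPair G A B)) := g • NormalWord.empty

/-- The number of stable letters in the normal form. -/
noncomputable def len (g : HNNExtension G A B φ) : ℕ := (normalForm g).toList.length

lemma normalForm_of_mul (a : G) (g : HNNExtension G A B φ) :
    normalForm (of a * g) = a • normalForm g := by
  rw [normalForm, mul_smul, of_smul_eq_smul]; rfl

lemma normalForm_t_mul (u : ℤˣ) (g : HNNExtension G A B φ) :
    normalForm (t ^ (u : ℤ) * g) = unitsSMul φ u (normalForm g) := by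
  rw [normalForm, mul_smul, t_pow_smul_eq_unitsSMul]; rfl

lemma len_of_mul (a : G) (g : HNNExtension G A B φ) : len (of a * g) = len g := by
  rw [len, normalForm_of_mul]; rfl

lemma len_one : len (1 : HNNExtension G A B φ) = 0 := by
  rw [len, normalForm, one_smul]; rfl

lemma len_of (a : G) : len (of a : HNNExtension G A B φ) = 0 := by
  rw [← mul_one (of a), len_of_mul, len_one]

lemma len_t_mul_of_not_cancels {u : ℤˣ} {g : HNNExtension G A B φ}
    (h : ¬ Cancels u (normalForm g)) : len (t ^ (u : ℤ) * g) = len g + 1 := by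
  rw [len, normalForm_t_mul, unitsSMul, dif_neg h]
  simp [len]

lemma len_t_mul_of_cancels {u : ℤˣ} {g : HNNExtension G A B φ}
    (h : Cancels u (normalForm g)) : len (t ^ (u : ℤ) * g) + 1 = len g := by
  have h1 := len_t_mul_of_not_cancels (u := -u) (g := t ^ (u : ℤ) * g) (by
    rw [normalForm_t_mul, unitsSMul_cancels_iff]
    exact not_not.2 h)
  rw [← h1, ← mul_assoc, ← zpow_add]
  simp

lemma len_t_mul_le (u : ℤˣ) (g : HNNExtension G A B φ) : len (t ^ (u : ℤ) * g) ≤ len g + 1 := by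
  by_cases h : Cancels u (normalForm g)
  · have := len_t_mul_of_cancels h; omega
  · exact (len_t_mul_of_not_cancels h).le

lemma exists_of_len_eq_zero {g : HNNExtension G A B φ} (h : len g = 0) : ∃ a, g = of a := by
  have h1 : (normalForm g).prod φ = g := (NormalWord.equiv φ _).symm_apply_apply g
  rw [ReducedWord.prod, List.length_eq_zero_iff.1 h, List.map_nil, List.prod_nil, mul_one] at h1
  exact ⟨_, h1.symm⟩

/-- A letter cancelling the first stable letter of an element. -/
lemma exists_cancels {g : HNNExtension G A B φ} (h : 0 < len g) :
    ∃ (u : ℤˣ) (a : G), Cancels u (normalForm (of a * g)) := by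
  obtain ⟨⟨u, x⟩, hx⟩ : ∃ p, (normalForm g).toList.head? = some p :=
    Option.isSome_iff_exists.1 (by
      rw [List.isSome_head?]; rintro h0; simp [len, h0] at h)
  refine ⟨-u, (normalForm g).head⁻¹, ?_⟩
  rw [normalForm_of_mul]
  simp [Cancels, hx, one_mem]

lemma len_mul_of (g : HNNExtension G A B φ) (b : G) : len (g * of b) = len g := by
  suffices key : ∀ n (g : HNNExtension G A B φ) (b : G), len g = n → len (g * of b) ≤ n by
    refine le_antisymm (key _ g b rfl) ?_
    have := key _ (g * of b) b⁻¹ rfl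
    rwa [mul_assoc, ← map_mul, mul_inv_cancel, map_one, mul_one] at this
  intro n
  induction n with
  | zero =>
    intro g b h
    obtain ⟨a, rfl⟩ := exists_of_len_eq_zero h
    rw [← map_mul, len_of]
  | succ n ih =>
    intro g b h
    obtain ⟨u, a, hc⟩ := exists_cancels (show 0 < len g by omega)
    have h1 := len_t_mul_of_cancels hc
    rw [len_of_mul, h] at h1
    have h2 := ih _ b (Nat.succ_injective h1)
    have h3 : g * of b = of a⁻¹ * (t ^ ((-u : ℤˣ) : ℤ) * (t ^ (u : ℤ) * (of a * g) * of b)) := by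
      simp [mul_assoc]
    rw [h3, len_of_mul]
    exact (len_t_mul_le _ _).trans (by omega)

lemma len_t (u : ℤˣ) : len (t ^ (u : ℤ) : HNNExtension G A B φ) = 1 := by
  have h : ¬ Cancels u (normalForm (1 : HNNExtension G A B φ)) := by
    rw [normalForm, one_smul]; simp [Cancels]
  simpa [len_one] using len_t_mul_of_not_cancels h

lemma len_eq_one_iff {g : HNNExtension G A B φ} :
    len g = 1 ↔ ∃ (a : G) (u : ℤˣ) (b : G), g = of a * t ^ (u : ℤ) * of b := by
  constructor
  · intro h
    obtain ⟨u, a, hc⟩ := exists_cancels (show 0 < len g by omega)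
    have h1 := len_t_mul_of_cancels hc
    rw [len_of_mul, h] at h1
    obtain ⟨b, hb⟩ := exists_of_len_eq_zero (Nat.succ_injective h1)
    refine ⟨a⁻¹, -u, b, ?_⟩
    rw [← hb]
    simp [mul_assoc]
  · rintro ⟨a, u, b, rfl⟩
    rw [len_mul_of, len_of_mul, len_t]

/-- The vertices of the Bass–Serre tree. -/
abbrev Vertex (G : Type*) [Group G] (A B : Subgroup G) (φ : A ≃* B) : Type _ :=
  HNNExtension G A B φ ⧸ (of : G →* HNNExtension G A B φ).range

/-- The distance in the Bass–Serre tree. -/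
noncomputable def treeDist (x y : Vertex G A B φ) : ℕ := len (x.out⁻¹ * y.out)

lemma treeDist_mk (g h : HNNExtension G A B φ) :
    treeDist (g : Vertex G A B φ) (h : Vertex G A B φ) = len (g⁻¹ * h) := by
  obtain ⟨⟨_, a, rfl⟩, ha⟩ := QuotientGroup.mk_out_eq_mul (of : G →* HNNExtension G A B φ).range g
  obtain ⟨⟨_, b, rfl⟩, hb⟩ := QuotientGroup.mk_out_eq_mul (of : G →* HNNExtension G A B φ).range h
  rw [treeDist, ha, hb, mul_inv_rev, ← map_inv, mul_assoc, len_of_mul, ← mul_assoc, len_mul_of]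

lemma treeDist_smul (g : HNNExtension G A B φ) (x y : Vertex G A B φ) :
    treeDist (g • x) (g • y) = treeDist x y := by
  induction x using QuotientGroup.induction_on with | _ x
  induction y using QuotientGroup.induction_on with | _ y
  change treeDist ((g * x : HNNExtension G A B φ) : Vertex G A B φ)
    ((g * y : HNNExtension G A B φ) : Vertex G A B φ) = _
  rw [treeDist_mk, treeDist_mk]
  simp [mul_assoc]

/-- Moving along the stable letter that does not cancel leads away. -/
lemma mk_of_mul_t_eq {a a' : G} {u : ℤˣ} (h : a⁻¹ * a' ∈ toSubgroup A B (-u)) :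
    ((of a * t ^ (u : ℤ) : HNNExtension G A B φ) : Vertex G A B φ) =
      ((of a' * t ^ (u : ℤ) : HNNExtension G A B φ) : Vertex G A B φ) := by
  rw [QuotientGroup.eq]
  rcases Int.units_eq_one_or u with rfl | rfl
  · refine ⟨φ.symm ⟨_, h⟩, ?_⟩
    rw [equiv_symm_eq_conj]
    simp [mul_assoc]
  · simp only [neg_neg, toSubgroup_one] at h
    refine ⟨φ ⟨_, h⟩, ?_⟩
    rw [equiv_eq_conj]
    simp [mul_assoc]

lemma isTreeDist : IsTreeDist (treeDist : Vertex G A B φ → Vertex G A B φ → ℕ) where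
  eq_zero_iff x y := by
    induction x using QuotientGroup.induction_on with | _ x
    induction y using QuotientGroup.induction_on with | _ y
    rw [treeDist_mk, QuotientGroup.eq]
    constructor
    · intro h
      obtain ⟨a, ha⟩ := exists_of_len_eq_zero h
      exact ⟨a, ha.symm⟩
    · rintro ⟨a, ha⟩
      rw [← ha, len_of]
  adj_symm x y := by
    induction x using QuotientGroup.induction_on with | _ x
    induction y using QuotientGroup.induction_on with | _ y
    rw [treeDist_mk, treeDist_mk, len_eq_one_iff, len_eq_one_iff]
    rintro ⟨a, u, b, h⟩
    refine ⟨b⁻¹, -u, a⁻¹, ?_⟩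
    rw [← inv_inj, mul_inv_rev, inv_inv, h]
    simp [mul_assoc]
  exists_next x y hxy := by
    induction x using QuotientGroup.induction_on with | _ x
    induction y using QuotientGroup.induction_on with | _ y
    have hpos : 0 < len (x⁻¹ * y) := by
      by_contra h
      obtain ⟨a, ha⟩ := exists_of_len_eq_zero (Nat.eq_zero_of_not_pos h)
      exact hxy (QuotientGroup.eq.2 ⟨a, ha.symm⟩)
    obtain ⟨u, a, hc⟩ := exists_cancels hpos
    have h1 := len_t_mul_of_cancels hc
    rw [len_of_mul] at h1
    refine ⟨((x * (of a⁻¹ * t ^ ((-u : ℤˣ) : ℤ)) : HNNExtension G A B φ) : Vertex G A B φ), ?_, ?_,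
      fun w hw hne => ?_⟩
    · rw [treeDist_mk, inv_mul_cancel_left, len_of_mul, len_t]
    · rw [treeDist_mk, treeDist_mk, ← h1]
      simp [mul_assoc]
    · induction w using QuotientGroup.induction_on with | _ w
      rw [treeDist_mk, len_eq_one_iff] at hw
      obtain ⟨a', u', b', hw⟩ := hw
      have hw' : (w : Vertex G A B φ) =
          ((x * (of a' * t ^ (u' : ℤ)) : HNNExtension G A B φ) : Vertex G A B φ) := by
        rw [eq_comm, QuotientGroup.eq, mul_inv_rev, mul_assoc, hw]
        exact ⟨b', by simp [mul_assoc]⟩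
      rw [hw'] at hne ⊢
      rw [treeDist_mk, treeDist_mk]
      have hnc : ¬ Cancels (-u') (normalForm (of a'⁻¹ * (x⁻¹ * y))) := by
        intro hc'
        apply hne
        rw [normalForm_of_mul] at hc hc'
        have huu : u' = -u := by
          have := hc.2.symm.trans hc'.2
          simpa using (Option.some_injective _ this).symm
        subst huu
        rw [neg_neg] at hc'
        have hm := mul_mem hc'.1 (inv_mem hc.1)
        refine congrArg (fun v : Vertex G A B φ => x • v) (mk_of_mul_t_eq (a := a') (a' := a⁻¹) ?_)
        rw [neg_neg]
        simpa [mul_assoc] using hm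
      have := len_t_mul_of_not_cancels hnc
      rw [len_of_mul] at this
      rw [← this]
      simp [mul_assoc]

/-- The base vertex, stabilised by the base group. -/
def base : Vertex G A B φ := ((1 : HNNExtension G A B φ) : Vertex G A B φ)

lemma smul_base (g : HNNExtension G A B φ) : g • (base : Vertex G A B φ) = (g : Vertex G A B φ) :=
  congrArg (QuotientGroup.mk (s := (of : G →* HNNExtension G A B φ).range)) (mul_one g)

lemma exists_eq_smul_base (x : Vertex G A B φ) : ∃ g : HNNExtension G A B φ, x = g • base := by
  induction x using QuotientGroup.induction_on with | _ x
  exact ⟨x, (smul_base x).symm⟩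

lemma smul_base_eq_smul_base_iff {g h : HNNExtension G A B φ} :
    g • (base : Vertex G A B φ) = h • base ↔ ∃ a, h = g * of a := by
  rw [smul_base, smul_base, QuotientGroup.eq]
  exact ⟨fun ⟨a, ha⟩ => ⟨a, by rw [ha, mul_inv_cancel_left]⟩, fun ⟨a, ha⟩ => ⟨a, by simp [ha]⟩⟩

lemma smul_smul_base_eq_iff {k g : HNNExtension G A B φ} :
    k • g • (base : Vertex G A B φ) = g • base ↔ ∃ a, k = g * of a * g⁻¹ := by
  rw [eq_comm, smul_smul, smul_base_eq_smul_base_iff]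
  refine exists_congr fun a => ?_
  rw [eq_mul_inv_iff_mul_eq]

lemma smul_base_eq_iff {k : HNNExtension G A B φ} :
    k • (base : Vertex G A B φ) = base ↔ ∃ a, k = of a := by
  simpa using smul_smul_base_eq_iff (k := k) (g := 1)

/-- Oriented edges of the Bass–Serre tree. -/
def Edge (x y : Vertex G A B φ) : Prop :=
  ∃ g : HNNExtension G A B φ, x = g • base ∧ y = (g * t) • base

lemma Edge.smul {x y : Vertex G A B φ} (h : Edge x y) (k : HNNExtension G A B φ) :
    Edge (k • x) (k • y) := by
  obtain ⟨g, rfl, rfl⟩ := h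
  exact ⟨k * g, by rw [mul_smul], by rw [mul_assoc, mul_smul k]⟩

lemma treeDist_eq_one_iff {x y : Vertex G A B φ} : treeDist x y = 1 ↔ Edge x y ∨ Edge y x := by
  constructor
  · obtain ⟨g, rfl⟩ := exists_eq_smul_base x
    obtain ⟨h, rfl⟩ := exists_eq_smul_base y
    rw [smul_base, smul_base, treeDist_mk, len_eq_one_iff, ← smul_base, ← smul_base]
    rintro ⟨a, u, b, hu⟩
    rcases Int.units_eq_one_or u with rfl | rfl
    · left
      refine ⟨g * of a, smul_base_eq_smul_base_iff.2 ⟨a, rfl⟩,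
        smul_base_eq_smul_base_iff.2 ⟨b⁻¹, ?_⟩⟩
      rw [inv_mul_eq_iff_eq_mul.1 hu]
      simp [mul_assoc]
    · right
      refine ⟨h * of b⁻¹, smul_base_eq_smul_base_iff.2 ⟨b⁻¹, rfl⟩,
        smul_base_eq_smul_base_iff.2 ⟨a, ?_⟩⟩
      rw [inv_mul_eq_iff_eq_mul.1 hu]
      simp [mul_assoc]
  · have key : ∀ g : HNNExtension G A B φ,
        treeDist (g • (base : Vertex G A B φ)) ((g * t) • base) = 1 := fun g => by
      rw [smul_base, smul_base, treeDist_mk, inv_mul_cancel_left]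
      simpa using len_t (φ := φ) 1
    rintro (⟨g, rfl, rfl⟩ | ⟨g, rfl, rfl⟩)
    · exact key g
    · exact isTreeDist.adj_symm _ _ (key g)

/-- The exponent sum of the stable letter. -/
def exponent : HNNExtension G A B φ →* Multiplicative ℤ :=
  lift 1 (Multiplicative.ofAdd 1) (by simp)

lemma exponent_of (a : G) : exponent (of a : HNNExtension G A B φ) = 1 := by simp [exponent]

lemma exponent_t : exponent (t : HNNExtension G A B φ) = Multiplicative.ofAdd 1 := by
  simp [exponent]

lemma exponent_eq_one_of_mul_self {k : HNNExtension G A B φ} (hk : k * k = 1) : exponent k = 1 := by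
  have h := congrArg exponent hk
  rw [map_mul, map_one] at h
  have h' : (exponent k).toAdd + (exponent k).toAdd = 0 := h
  exact Multiplicative.toAdd.injective (by rw [toAdd_one]; omega)

lemma exponent_eq_of_smul_base_eq {g h : HNNExtension G A B φ}
    (e : g • (base : Vertex G A B φ) = h • base) : exponent g = exponent h := by
  obtain ⟨a, rfl⟩ := smul_base_eq_smul_base_iff.1 e
  simp [exponent_of]

lemma Edge.not_smul {x : Vertex G A B φ} {k : HNNExtension G A B φ} (hk : k * k = 1) :
    ¬ Edge x (k • x) := by
  rintro ⟨g, rfl, h⟩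
  rw [smul_smul] at h
  have := exponent_eq_of_smul_base_eq h
  simp [exponent_eq_one_of_mul_self hk, exponent_t] at this

lemma treeDist_smul_ne_one {k : HNNExtension G A B φ} (hk : k * k = 1) (x : Vertex G A B φ) :
    treeDist x (k • x) ≠ 1 := by
  rw [Ne, treeDist_eq_one_iff]
  rintro (h | h)
  · exact Edge.not_smul hk h
  · refine Edge.not_smul (x := k • x) hk ?_
    rwa [smul_smul, hk, one_smul]

lemma mem_toSubgroup_of_len_eq_zero {u : ℤˣ} {c : G}
    (h : len (t ^ (u : ℤ) * (of c * t ^ ((-u : ℤˣ) : ℤ)) : HNNExtension G A B φ) = 0) :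
    c ∈ toSubgroup A B u := by
  have h1 : Cancels u (normalForm (of c * t ^ ((-u : ℤˣ) : ℤ) : HNNExtension G A B φ)) := by
    by_contra hc
    have := len_t_mul_of_not_cancels hc
    omega
  have h2 : Cancels u (normalForm (t ^ ((-u : ℤˣ) : ℤ) : HNNExtension G A B φ)) := by
    by_contra hc
    have := len_t_mul_of_not_cancels hc
    rw [← zpow_add] at this
    simp [len_one] at this
  rw [normalForm_of_mul] at h1
  exact (Subgroup.mul_mem_cancel_right _ h2.1).1 h1.1

/-- The stabiliser of an edge. -/
lemma Edge.exists_eq_of_smul_eq {x y : Vertex G A B φ} (h : Edge x y) {k : HNNExtension G A B φ}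
    (hx : k • x = x) (hy : k • y = y) : ∃ (g : HNNExtension G A B φ) (a : A),
      x = g • base ∧ y = (g * t) • base ∧ k = g * of (φ a : G) * g⁻¹ := by
  obtain ⟨g, rfl, rfl⟩ := h
  obtain ⟨c, rfl⟩ := smul_smul_base_eq_iff.1 hx
  obtain ⟨e, he⟩ := smul_smul_base_eq_iff.1 hy
  have hc : c ∈ toSubgroup A B (-1) := by
    refine mem_toSubgroup_of_len_eq_zero (φ := φ) ?_
    have : t ^ (((-1 : ℤˣ)) : ℤ) * (of c * t ^ ((-(-1) : ℤˣ) : ℤ)) =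
        (of e : HNNExtension G A B φ) := by
      have h1 : of c = t * of e * (t⁻¹ : HNNExtension G A B φ) := by
        simpa [mul_assoc] using congrArg (fun z => g⁻¹ * z * g) he
      rw [h1]
      simp [mul_assoc]
    rw [this, len_of]
  exact ⟨g, φ.symm ⟨c, hc⟩, rfl, rfl, by simp⟩

end HNNExtension

section Good

variable {G : Type*} [Group G]

/-- The condition on the associated subgroups making the Bass–Serre tree sufficiently acylindrical
for powers of products of two involutions. -/
structure Admissible (A B : Subgroup G) : Prop where
  mul_self_eq_one_or : ∀ x ∈ A, x * x = 1 ∨ IsTranslationPow x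
  mem_left : ∀ p g : G, IsTranslationPow p → p ∈ A → g⁻¹ * p * g ∈ A → g ∈ A
  notMem : ∀ p g : G, IsTranslationPow p → p ∈ B → g⁻¹ * p * g ∉ A

/-- The inductive hypothesis on a group with a distinguished pair of distinct involutions. -/
structure IsGood (r₀ s₀ : G) : Prop where
  left : IsInvol r₀
  right : IsInvol s₀
  ne : r₀ ≠ s₀
  involFree : InvolFree G
  pair : ∀ r s : G, IsInvol r → IsInvol s → r ≠ s → PairConj r s r₀ s₀ ∨ IsDihedralPair r s
  conj_of_mem : ∀ r s : G, IsInvol r → IsInvol s → r ≠ s → r ∈ powNormalizer (r₀ * s₀) →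
    s ∈ powNormalizer (r₀ * s₀) → PairConj r s r₀ s₀
  eq_one : ∀ g : G, g * r₀ * g⁻¹ = r₀ → g * s₀ * g⁻¹ = s₀ → g = 1

end Good

namespace HNNExtension

variable {G : Type*} [Group G] {A B : Subgroup G} {φ : A ≃* B}

lemma conj_eq_of_conj_eq {Γ : Type*} [Group Γ] {u a b c : Γ}
    (h : u * a * u⁻¹ = u * c * b * c⁻¹ * u⁻¹) : c⁻¹ * a * c = b := by
  have h' : a = c * b * c⁻¹ := mul_left_cancel (mul_right_cancel (b := u⁻¹) (by
    rw [h]; group))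
  rw [h']
  group

lemma Edge.eq_of_smul_eq (hA : Admissible A B) {x y z : Vertex G A B φ} (hx : Edge x y)
    (hz : Edge z y) {k : HNNExtension G A B φ} (kx : k • x = x) (ky : k • y = y) (kz : k • z = z)
    (hk : k * k ≠ 1) : x = z := by
  obtain ⟨g₁, a₁, rfl, rfl, h₁⟩ := hx.exists_eq_of_smul_eq kx ky
  obtain ⟨g₂, a₂, rfl, hy, h₂⟩ := hz.exists_eq_of_smul_eq kz ky
  obtain ⟨c, hc⟩ := smul_base_eq_smul_base_iff.1 hy
  have hg₂ : g₂ = g₁ * t * of c * t⁻¹ := by rw [← hc, mul_inv_cancel_right]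
  rw [equiv_eq_conj] at h₁ h₂
  have ha : c⁻¹ * a₁ * c = a₂ := by
    apply of_injective φ
    have := h₁.symm.trans h₂
    rw [hg₂] at this
    rw [map_mul, map_mul, map_inv]
    exact conj_eq_of_conj_eq (u := g₁ * t) (by simpa [mul_assoc] using this)
  have hT : IsTranslationPow (a₁ : G) := by
    refine (hA.mul_self_eq_one_or _ a₁.2).resolve_left fun h => hk ?_
    rw [h₁]
    have : (of (a₁ : G) : HNNExtension G A B φ) * of (a₁ : G) = 1 := by rw [← map_mul, h, map_one]
    calc _ = g₁ * t * (of (a₁ : G) * of (a₁ : G)) * t⁻¹ * g₁⁻¹ := by group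
      _ = 1 := by rw [this]; group
  have hcA := hA.mem_left _ c hT a₁.2 (ha ▸ a₂.2)
  refine smul_base_eq_smul_base_iff.2 ⟨φ ⟨c, hcA⟩, ?_⟩
  rw [equiv_eq_conj, hg₂]
  group

lemma Edge.mul_self_eq_one (hA : Admissible A B) {x y z : Vertex G A B φ} (hx : Edge x y)
    (hz : Edge y z) {k : HNNExtension G A B φ} (kx : k • x = x) (ky : k • y = y)
    (kz : k • z = z) : k * k = 1 := by
  obtain ⟨g₁, a₁, rfl, rfl, h₁⟩ := hx.exists_eq_of_smul_eq kx ky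
  obtain ⟨g₂, a₂, hy, rfl, h₂⟩ := hz.exists_eq_of_smul_eq ky kz
  obtain ⟨c, rfl⟩ := smul_base_eq_smul_base_iff.1 hy
  rw [equiv_eq_conj] at h₁
  have ha : c⁻¹ * a₁ * c = φ a₂ := by
    apply of_injective φ
    have := h₁.symm.trans h₂
    rw [map_mul, map_mul, map_inv]
    exact conj_eq_of_conj_eq (u := g₁ * t) (by simpa [mul_assoc] using this)
  rcases hA.mul_self_eq_one_or _ a₁.2 with h | h
  · rw [h₁]
    have : (of (a₁ : G) : HNNExtension G A B φ) * of (a₁ : G) = 1 := by rw [← map_mul, h, map_one]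
    calc _ = g₁ * t * (of (a₁ : G) * of (a₁ : G)) * t⁻¹ * g₁⁻¹ := by group
      _ = 1 := by rw [this]; group
  · refine absurd ?_ (hA.notMem _ c⁻¹ (h.conj c) (ha ▸ (φ a₂).2))
    have : c⁻¹⁻¹ * (c⁻¹ * a₁ * c) * c⁻¹ = a₁ := by group
    rw [this]
    exact a₁.2

/-- An element fixing a path of length three has order at most two. -/
lemma mul_self_eq_one_of_three_le (hA : Admissible A B) {x y : Vertex G A B φ}
    {k : HNNExtension G A B φ} (kx : k • x = x) (ky : k • y = y) (h : 3 ≤ treeDist x y) :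
    k * k = 1 := by
  have hd := isTreeDist (φ := φ)
  have hnext : ∀ z : Vertex G A B φ, k • z = z → 0 < treeDist z y →
      ∃ w, k • w = w ∧ treeDist w y + 1 = treeDist z y ∧ (Edge z w ∨ Edge w z) := fun z kz hz => by
    obtain ⟨w, h1, h2, -⟩ := hd.exists_next z y (by rintro rfl; simp [hd.self] at hz)
    exact ⟨w, hd.smul_eq_of_between treeDist_smul kz ky (by omega), h2, treeDist_eq_one_iff.1 h1⟩
  obtain ⟨x₁, k₁, d₁, e₁⟩ := hnext x kx (by omega)
  obtain ⟨x₂, k₂, d₂, e₂⟩ := hnext x₁ k₁ (by omega)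
  obtain ⟨x₃, k₃, d₃, e₃⟩ := hnext x₂ k₂ (by omega)
  by_contra hk
  rcases e₂ with e₂ | e₂
  · rcases e₃ with e₃ | e₃
    · exact hk (e₂.mul_self_eq_one hA e₃ k₁ k₂ k₃)
    · have := e₂.eq_of_smul_eq hA e₃ k₁ k₂ k₃ hk
      rw [this] at d₂
      omega
  · rcases e₁ with e₁ | e₁
    · have := e₁.eq_of_smul_eq hA e₂ kx k₁ k₂ hk
      rw [this] at d₁
      omega
    · exact hk (e₂.mul_self_eq_one hA e₁ k₂ k₁ kx)

lemma not_edge_base {τ : G} (hτ : ∀ g, g⁻¹ * τ * g ∉ A) {x : Vertex G A B φ}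
    (hx : (of τ : HNNExtension G A B φ) • x = x) : ¬ Edge x base := by
  intro h
  obtain ⟨g, a, -, h1, h2⟩ := h.exists_eq_of_smul_eq hx (smul_base_eq_iff.2 ⟨τ, rfl⟩)
  obtain ⟨c, hc⟩ := smul_base_eq_iff.1 h1.symm
  refine hτ c ?_
  have : c⁻¹ * τ * c = a := by
    apply of_injective φ
    rw [equiv_eq_conj] at h2
    rw [map_mul, map_mul, map_inv, h2, ← hc]
    group
  rw [this]
  exact a.2

/-- The commensurator of an element none of whose powers are conjugate into `A`. -/
lemma powNormalizer_of (hA : Admissible A B) {τ : G} (hfin : ¬ IsOfFinOrder τ)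
    (hτ : ∀ n : ℤ, n ≠ 0 → ∀ g, g⁻¹ * τ ^ n * g ∉ A) :
    powNormalizer (of τ : HNNExtension G A B φ) = (powNormalizer τ).map of := by
  apply le_antisymm
  · rintro γ ⟨a, b, ha, hb, hab⟩
    rw [← map_zpow, ← map_zpow] at hab
    suffices h : γ • (base : Vertex G A B φ) = base by
      obtain ⟨c, rfl⟩ := smul_base_eq_iff.1 h
      refine ⟨c, ⟨a, b, ha, hb, of_injective φ ?_⟩, rfl⟩
      simpa using hab
    by_contra hne
    have hd := isTreeDist (φ := φ)
    have k0 : (of (τ ^ b) : HNNExtension G A B φ) • (base : Vertex G A B φ) = base :=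
      smul_base_eq_iff.2 ⟨_, rfl⟩
    have kγ : (of (τ ^ b) : HNNExtension G A B φ) • γ • (base : Vertex G A B φ) = γ • base := by
      rw [← hab, smul_smul, inv_mul_cancel_right, mul_smul, smul_base_eq_iff.2 ⟨_, rfl⟩]
    have hkk : (of (τ ^ b) : HNNExtension G A B φ) * of (τ ^ b) ≠ 1 := by
      rw [← map_mul, ← zpow_add, Ne, map_eq_one_iff _ (of_injective φ)]
      exact zpow_ne_one_of_not_isOfFinOrder hfin (by omega)
    obtain ⟨x₁, h1, h2, -⟩ := hd.exists_next base _ (Ne.symm hne)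
    have k1 := hd.smul_eq_of_between treeDist_smul k0 kγ (z := x₁) (by omega)
    have e1 := (treeDist_eq_one_iff.1 h1).resolve_right (not_edge_base (hτ b hb) k1)
    by_cases hx : x₁ = γ • base
    · subst hx
      have e2 := e1.smul γ⁻¹
      rw [inv_smul_smul] at e2
      refine not_edge_base (hτ a ha) ?_ e2
      have : of (τ ^ a) = γ⁻¹ * of (τ ^ b) * γ := by rw [← hab]; group
      rw [this, smul_smul, mul_inv_cancel_right, mul_smul, k0]
    · obtain ⟨x₂, h3, h4, -⟩ := hd.exists_next x₁ _ hx
      have k2 := hd.smul_eq_of_between treeDist_smul k1 kγ (z := x₂) (by omega)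
      rcases treeDist_eq_one_iff.1 h3 with e2 | e2
      · exact hkk (e1.mul_self_eq_one hA e2 k0 k1 k2)
      · have := e1.eq_of_smul_eq hA e2 k0 k1 k2 hkk
        rw [← this] at h4
        omega
  · rintro _ ⟨x, ⟨m, n, hm, hn, h⟩, rfl⟩
    exact ⟨m, n, hm, hn, by rw [← map_zpow, ← map_zpow, ← h]; simp⟩

/-- Two distinct involutions are simultaneously conjugate into the base group, or their product
is a translation. -/
lemma exists_pairConj_or_translates {r s : HNNExtension G A B φ} (hr : IsInvol r) (hs : IsInvol s)
    (hrs : r ≠ s) :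
    (∃ r' s' : G, IsInvol r' ∧ IsInvol s' ∧ r' ≠ s' ∧ PairConj (of r') (of s') r s) ∨
    ∃ (x : Vertex G A B φ) (ℓ : ℕ), 2 ≤ ℓ ∧ r • x = x ∧
      IsTreeDist.Translates treeDist (r * s) x ℓ := by
  have hd := isTreeDist (φ := φ)
  obtain ⟨x₀, hx₀⟩ := hd.exists_fixed_of_sq treeDist_smul hr.mul_self
    (treeDist_smul_ne_one hr.mul_self) base
  obtain ⟨y₀, hy₀⟩ := hd.exists_fixed_of_sq treeDist_smul hs.mul_self
    (treeDist_smul_ne_one hs.mul_self) base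
  obtain ⟨⟨x, y⟩, ⟨hx, hy⟩, hmin⟩ := (measure fun p : Vertex G A B φ × Vertex G A B φ =>
    treeDist p.1 p.2).wf.has_min {p | r • p.1 = p.1 ∧ s • p.2 = p.2} ⟨(x₀, y₀), hx₀, hy₀⟩
  have hmin' : ∀ x' y', r • x' = x' → s • y' = y' → treeDist x y ≤ treeDist x' y' :=
    fun x' y' hx' hy' => not_lt.1 (hmin (x', y') ⟨hx', hy'⟩)
  dsimp only at hx hy
  rcases Nat.eq_zero_or_pos (treeDist x y) with h0 | hpos
  · left
    obtain rfl := (hd.eq_zero_iff _ _).1 h0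
    obtain ⟨g, rfl⟩ := exists_eq_smul_base x
    obtain ⟨r', rfl⟩ := smul_smul_base_eq_iff.1 hx
    obtain ⟨s', rfl⟩ := smul_smul_base_eq_iff.1 hy
    have hinv : ∀ u : G, IsInvol (g * of u * g⁻¹) → IsInvol u := fun u hu => by
      rw [← IsInvol.map_iff (of_injective φ)]
      have := hu.conj g⁻¹
      rwa [show g⁻¹ * (g * of u * g⁻¹) * g⁻¹⁻¹ = of u by group] at this
    exact ⟨r', s', hinv _ hr, hinv _ hs, fun h => hrs (by rw [h]), g, rfl, rfl⟩
  · exact .inr ⟨x, 2 * treeDist x y, by omega, hx, by omega,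
      hd.dist_mul_pow_smul treeDist_smul hx hy hmin' hpos⟩

lemma involFree (hG : InvolFree G) : InvolFree (HNNExtension G A B φ) := by
  intro r s hr hs hrs
  rcases exists_pairConj_or_translates hr hs hrs with
    ⟨r', s', hr', hs', hrs', g, rfl, rfl⟩ | ⟨x, ℓ, -, -, h⟩
  · rw [show g * of r' * g⁻¹ * (g * of s' * g⁻¹) = MulAut.conj g (of (r' * s')) by simp [mul_assoc]]
    intro h
    refine hG r' s' hr' hs' hrs' ?_
    exact (of_injective φ).isOfFinOrder_iff.1
      ((Function.Injective.isOfFinOrder_iff (f := (MulAut.conj g).toMonoidHom)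
        (MulAut.conj g).injective).1 h)
  · exact h.not_isOfFinOrder isTreeDist

lemma isDihedralPair_of_translates (hA : Admissible A B) (hG : InvolFree G)
    {r s : HNNExtension G A B φ} (hr : IsInvol r) (hs : IsInvol s) {x : Vertex G A B φ} {ℓ : ℕ}
    (hℓ : 2 ≤ ℓ) (hx : r • x = x) (h : IsTreeDist.Translates treeDist (r * s) x ℓ) :
    IsDihedralPair r s := by
  have hd := isTreeDist (φ := φ)
  have hΓ := involFree (φ := φ) hG
  obtain ⟨β, hβ⟩ := h.exists_busemannHom hd treeDist_smul
  have hdist : treeDist x ((r * s) ^ (2 : ℤ) • x) = ℓ * 2 := h.dist_pow 2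
  have hsq : ∀ k : HNNExtension G A B φ, (∀ j : ℤ, k • (r * s) ^ j • x = (r * s) ^ j • x) →
      k * k = 1 := fun k hk =>
    mul_self_eq_one_of_three_le hA (by simpa using hk 0) (hk 2) (by omega)
  have hrj : ∀ j : ℤ, r • (r * s) ^ j • x = (r * s) ^ (-j) • x := fun j => by
    rw [← mul_zpow_mul_of_isInvol hr hs, mul_smul, hx, mul_smul]
  have hone : ∀ k : HNNExtension G A B φ, (∀ j : ℤ, k • (r * s) ^ j • x = (r * s) ^ j • x) →
      k = 1 := fun k hk => by
    by_contra hk1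
    have hki : IsInvol k := isInvol_iff.2 ⟨hsq k hk, hk1⟩
    have hki' := hki.conj r
    have hfix' : ∀ j : ℤ, (r * k * r⁻¹) • (r * s) ^ j • x = (r * s) ^ j • x := fun j => by
      rw [hr.inv_eq, mul_smul, mul_smul, hrj, hk, hrj, neg_neg]
    have hcomm : k = r * k * r⁻¹ := by
      by_contra hne
      refine hΓ k _ hki hki' hne (isOfFinOrder_iff_pow_eq_one.2 ⟨2, two_pos, ?_⟩)
      rw [pow_two]
      exact hsq _ fun j => by rw [mul_smul, hfix', hk]
    have hkr : k = r := by
      by_contra hne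
      refine hΓ k r hki hr hne (isOfFinOrder_iff_pow_eq_one.2 ⟨2, two_pos, ?_⟩)
      rw [hr.inv_eq] at hcomm
      calc (k * r) ^ 2 = k * (r * k * r) := by rw [pow_two]; group
        _ = 1 := by rw [← hcomm, hki.mul_self]
    have h1 := hk 1
    rw [hkr, hrj] at h1
    have h2 : x = (r * s) ^ (2 : ℤ) • x := by
      calc x = (r * s) ^ (1 : ℤ) • (r * s) ^ (-1 : ℤ) • x := by rw [smul_smul, ← zpow_add]; simp
        _ = _ := by rw [h1, smul_smul, ← zpow_add]; rfl
    rw [← h2, hd.self] at hdist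
    omega
  refine isDihedralPair_of_injective hr hs (h.not_isOfFinOrder hd) β ?_
    fun g a b => h.natAbs_eq_of_conj hd treeDist_smul
  rw [injective_iff_map_eq_one]
  exact fun g hg => Subtype.ext (hone g (hβ g hg))

lemma pairConj_of_t (a a' : A) :
    PairConj (of (a : G)) (of (a' : G)) (of (φ a : G)) (of (φ a' : G) : HNNExtension G A B φ) :=
  ⟨t, (equiv_eq_conj a).symm, (equiv_eq_conj a').symm⟩

/-- HNN extensions along admissible subgroups preserve the inductive hypothesis. -/
lemma isGood {r₀ s₀ : G} (h : IsGood r₀ s₀) (hA : Admissible A B)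
    (h₀ : ∀ n : ℤ, n ≠ 0 → ∀ g, g⁻¹ * (r₀ * s₀) ^ n * g ∉ A) :
    IsGood (of r₀ : HNNExtension G A B φ) (of s₀) := by
  have hE : powNormalizer (of r₀ * of s₀ : HNNExtension G A B φ) =
      (powNormalizer (r₀ * s₀)).map of := by
    rw [← map_mul]
    exact powNormalizer_of hA (h.involFree _ _ h.left h.right h.ne) h₀
  have hell : ∀ r s : G, IsInvol r → IsInvol s → r ≠ s →
      (∀ n : ℤ, n ≠ 0 → ∀ g, g⁻¹ * (r * s) ^ n * g ∉ A) →
      PairConj (of r) (of s) (of r₀ : HNNExtension G A B φ) (of s₀) ∨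
      IsDihedralPair (of r : HNNExtension G A B φ) (of s) := fun r s hr hs hrs hn =>
    (h.pair r s hr hs hrs).imp (PairConj.map of) fun hp =>
      hp.map (of_injective φ) (powNormalizer_of hA (h.involFree _ _ hr hs hrs) hn)
  refine
  { left := (IsInvol.map_iff (of_injective φ)).2 h.left
    right := (IsInvol.map_iff (of_injective φ)).2 h.right
    ne := (of_injective φ).ne h.ne
    involFree := HNNExtension.involFree h.involFree
    pair := fun r s hr hs hrs => ?_
    conj_of_mem := fun r s hr hs hrs hr' hs' => ?_
    eq_one := fun g hgr hgs => ?_ }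
  · rcases exists_pairConj_or_translates hr hs hrs with
      ⟨r', s', hr', hs', hrs', hc⟩ | ⟨x, ℓ, hℓ, hx, ht⟩
    · suffices key : PairConj (of r') (of s') (of r₀ : HNNExtension G A B φ) (of s₀) ∨
          IsDihedralPair (of r' : HNNExtension G A B φ) (of s') from
        key.imp (fun hp => hc.symm.trans hp) fun hp => hp.of_pairConj hc
      by_cases hn : ∀ n : ℤ, n ≠ 0 → ∀ g, g⁻¹ * (r' * s') ^ n * g ∉ A
      · exact hell r' s' hr' hs' hrs' hn
      · push Not at hn
        obtain ⟨n, hn0, g, hg⟩ := hn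
        have hr₁ := hr'.conj g⁻¹
        have hs₁ := hs'.conj g⁻¹
        have hrs₁ := (conj_left_injective g⁻¹).ne hrs'
        have hpair : PairConj r' s' (g⁻¹ * r' * g⁻¹⁻¹) (g⁻¹ * s' * g⁻¹⁻¹) := ⟨g⁻¹, rfl, rfl⟩
        have hmem : ((g⁻¹ * r' * g⁻¹⁻¹) * (g⁻¹ * s' * g⁻¹⁻¹)) ^ n ∈ A := by
          rwa [show (g⁻¹ * r' * g⁻¹⁻¹) * (g⁻¹ * s' * g⁻¹⁻¹) = g⁻¹ * (r' * s') * g⁻¹⁻¹ by group,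
            conj_zpow, inv_inv]
        generalize g⁻¹ * r' * g⁻¹⁻¹ = r₁ at *
        generalize g⁻¹ * s' * g⁻¹⁻¹ = s₁ at *
        have hT : IsTranslationPow ((r₁ * s₁) ^ n) := ⟨r₁, s₁, n, hr₁, hs₁, hrs₁, hn0, rfl⟩
        have hrA : r₁ ∈ A := hA.mem_left _ _ hT hmem (by
          rw [hr₁.inv_eq, mul_zpow_mul_of_isInvol hr₁ hs₁, zpow_neg]
          exact inv_mem hmem)
        have hsA : s₁ ∈ A := hA.mem_left _ _ hT hmem (by
          rw [hs₁.inv_eq, mul_zpow_mul_of_isInvol' hr₁ hs₁, zpow_neg]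
          exact inv_mem hmem)
        have hinj : Function.Injective (B.subtype.comp φ.toMonoidHom) :=
          B.subtype_injective.comp φ.injective
        have hinv : ∀ a : A, IsInvol (a : G) → IsInvol (φ a : G) := fun a ha =>
          (IsInvol.map_iff (f := B.subtype.comp φ.toMonoidHom) hinj).2
            ((IsInvol.map_iff A.subtype_injective).1 ha)
        have hr₂ := hinv ⟨r₁, hrA⟩ hr₁
        have hs₂ := hinv ⟨s₁, hsA⟩ hs₁
        have hrs₂ : (φ ⟨r₁, hrA⟩ : G) ≠ φ ⟨s₁, hsA⟩ := fun e =>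
          hrs₁ (congrArg Subtype.val (hinj e))
        have hconj := (hpair.map of).trans (pairConj_of_t (φ := φ) ⟨r₁, hrA⟩ ⟨s₁, hsA⟩)
        refine (hell _ _ hr₂ hs₂ hrs₂ fun m hm g => ?_).imp (fun hp => hconj.trans hp)
          fun hp => hp.of_pairConj hconj.symm
        exact hA.notMem _ _ ⟨_, _, m, hr₂, hs₂, hrs₂, hm, rfl⟩
          (zpow_mem (mul_mem (φ _).2 (φ _).2) m)
    · exact .inr (isDihedralPair_of_translates hA h.involFree hr hs hℓ hx ht)
  · rw [hE] at hr' hs'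
    obtain ⟨r, hr', rfl⟩ := hr'
    obtain ⟨s, hs', rfl⟩ := hs'
    exact (h.conj_of_mem r s ((IsInvol.map_iff (of_injective φ)).1 hr)
      ((IsInvol.map_iff (of_injective φ)).1 hs) (fun e => hrs (by rw [e])) hr' hs').map of
  · have hg : g ∈ powNormalizer (of r₀ * of s₀ : HNNExtension G A B φ) := by
      refine ⟨1, 1, one_ne_zero, one_ne_zero, ?_⟩
      rw [zpow_one]
      conv_rhs => rw [← hgr, ← hgs]
      group
    rw [hE] at hg
    obtain ⟨g, -, rfl⟩ := hg
    rw [h.eq_one g (of_injective φ (by simpa using hgr))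
      (of_injective φ (by simpa using hgs)), map_one]

end HNNExtension

section Amalgamation

lemma conj_mem_powNormalizer {G : Type*} [Group G] {σ τ g x : G} {p q : ℤ} (hp : p ≠ 0)
    (h : g⁻¹ * σ ^ p * g = τ ^ q) (hx : x ∈ powNormalizer τ) :
    g * x * g⁻¹ ∈ powNormalizer σ := by
  obtain ⟨m, n, hm, hn, hx⟩ := hx
  have key : ∀ i : ℤ, σ ^ (p * i) = g * τ ^ (q * i) * g⁻¹ := fun i => by
    rw [zpow_mul τ, ← h, zpow_mul, ← conj_zpow]
    congr 1
    group
  refine ⟨p * m, p * n, mul_ne_zero hp hm, mul_ne_zero hp hn, ?_⟩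
  rw [key, key, mul_comm q n, zpow_mul τ n, ← hx, conj_zpow, ← zpow_mul, mul_comm m]
  group

variable {G : Type} [Group G] {r₀ s₀ r s : G}

lemma IsGood.pairConj_of_conj_mem (h : IsGood r₀ s₀) (hr : IsInvol r) (hs : IsInvol s)
    (hrs : r ≠ s) {ψ : DihedralGroup 0 →* G} (hE : ψ.range = powNormalizer (r * s)) {a : ℤ}
    (ha : a ≠ 0) {g : G} (hg : g⁻¹ * (r₀ * s₀) ^ a * g ∈ ψ.range) : PairConj r s r₀ s₀ := by
  have hT : IsTranslationPow ((r₀ * s₀) ^ a) := ⟨_, _, a, h.left, h.right, h.ne, ha, rfl⟩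
  obtain ⟨j, hj, hj'⟩ := eq_zpow_of_mem_range hg ((hT.conj g).not_isOfFinOrder h.involFree)
  obtain ⟨m, hm, hm'⟩ := eq_zpow_of_mem_range (hE ▸ self_mem_powNormalizer (r * s))
    (h.involFree r s hr hs hrs)
  have key : g⁻¹ * (r₀ * s₀) ^ (a * m) * g = (r * s) ^ j := by
    have := conj_zpow (a := g⁻¹) (b := (r₀ * s₀) ^ a) (i := m)
    rw [inv_inv, hj'] at this
    rw [zpow_mul, ← this, hm', ← zpow_mul, ← zpow_mul, mul_comm]
  have hmem := fun x => conj_mem_powNormalizer (x := x) (mul_ne_zero ha hm) key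
  have hc : PairConj r s (g * r * g⁻¹) (g * s * g⁻¹) := ⟨g, rfl, rfl⟩
  exact hc.trans (h.conj_of_mem _ _ (hr.conj g) (hs.conj g) ((conj_left_injective g).ne hrs)
    (hmem r (left_mem_powNormalizer hr hs)) (hmem s (right_mem_powNormalizer hr hs)))

instance HNNExtension.countable {G : Type*} [Group G] [Countable G] (A B : Subgroup G)
    (φ : A ≃* B) : Countable (HNNExtension G A B φ) := by
  have : Countable (FreeMonoid (G ⊕ Multiplicative ℤ)) :=
    inferInstanceAs (Countable (List (G ⊕ Multiplicative ℤ)))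
  have : Countable (Monoid.Coprod G (Multiplicative ℤ)) :=
    inferInstanceAs (Countable (Quotient _))
  exact inferInstanceAs (Countable (Quotient _))

/-- Any pair of distinct involutions can be made conjugate to the distinguished one. -/
lemma IsGood.exists_pairConj [Countable G] (h : IsGood r₀ s₀) (hr : IsInvol r) (hs : IsInvol s)
    (hrs : r ≠ s) : ∃ (Γ : Type) (_ : Group Γ) (_ : Countable Γ) (f : G →* Γ),
      Function.Injective f ∧ IsGood (f r₀) (f s₀) ∧ PairConj (f r) (f s) (f r₀) (f s₀) := by
  by_cases hc : PairConj r s r₀ s₀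
  · exact ⟨G, _, ‹_›, MonoidHom.id G, Function.injective_id, h, hc⟩
  obtain ⟨ψ, hψ, hE⟩ := (h.pair r s hr hs hrs).resolve_left hc
  have hinv : r₀ * (r₀ * s₀) * r₀ = (r₀ * s₀)⁻¹ := by
    simpa using mul_zpow_mul_of_isInvol h.left h.right 1
  have hτ₀ := h.involFree _ _ h.left h.right h.ne
  let ψ₀ := dihedralHom r₀ (r₀ * s₀) h.left.mul_self hinv
  have hψ₀r : ψ₀ (.r 1) = r₀ * s₀ := zpow_one (r₀ * s₀)
  have hψ₀i : Function.Injective ψ₀ := dihedralHom_injective h.left.ne_one hτ₀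
  have hB : ψ₀.range ≤ powNormalizer (r₀ * s₀) := by
    rintro _ ⟨i | i, rfl⟩
    · exact zpow_mem (self_mem_powNormalizer _) _
    · exact mul_mem (left_mem_powNormalizer h.left h.right)
        (zpow_mem (self_mem_powNormalizer _) _)
  let φ : ψ.range ≃* ψ₀.range :=
    (MonoidHom.ofInjective hψ).symm.trans (MonoidHom.ofInjective hψ₀i)
  have h₀ : ∀ n : ℤ, n ≠ 0 → ∀ g, g⁻¹ * (r₀ * s₀) ^ n * g ∉ ψ.range := fun n hn g hg =>
    hc (h.pairConj_of_conj_mem hr hs hrs hE hn hg)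
  obtain ⟨m, hm, hm'⟩ := eq_zpow_of_mem_range (hE ▸ self_mem_powNormalizer (r * s))
    (h.involFree r s hr hs hrs)
  have hA : Admissible ψ.range ψ₀.range :=
    { mul_self_eq_one_or := fun x hx => (mul_self_eq_one_or_of_mem_range hx).imp_right
        fun ⟨i, hi, hx⟩ => hx ▸ isTranslationPow_r_one_zpow hψ hi
      mem_left := fun p g hp hpA hgA => by
        obtain ⟨i, hi, rfl⟩ := eq_zpow_of_mem_range hpA (hp.not_isOfFinOrder h.involFree)
        obtain ⟨j, hj, hij⟩ := eq_zpow_of_mem_range hgA ((hp.conj g).not_isOfFinOrder h.involFree)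
        rw [hE]
        refine ⟨j, i, hj, hi, ?_⟩
        rw [hm', ← zpow_mul, ← zpow_mul, mul_comm m, mul_comm m, zpow_mul _ j, ← hij, ← conj_zpow,
          zpow_mul _ i]
        congr 1
        group
      notMem := fun p g hp hpB hgA => by
        obtain ⟨i, hi, rfl⟩ := eq_zpow_of_mem_range hpB (hp.not_isOfFinOrder h.involFree)
        refine h₀ i hi g ?_
        rwa [hψ₀r] at hgA }
  have hinj := HNNExtension.of_injective φ
  refine ⟨HNNExtension G _ _ φ, inferInstance, inferInstance, HNNExtension.of, hinj,
    HNNExtension.isGood h hA h₀, ?_⟩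
  let ρ : ψ.range →* G := ψ₀.range.subtype.comp φ.toMonoidHom
  have hρ : Function.Injective ρ := ψ₀.range.subtype_injective.comp φ.injective
  have hρi : ∀ a : ψ.range, IsInvol (a : G) → IsInvol (ρ a) := fun a ha =>
    (IsInvol.map_iff hρ).2 ((IsInvol.map_iff ψ.range.subtype_injective).1 ha)
  have hrA : r ∈ ψ.range := hE ▸ left_mem_powNormalizer hr hs
  have hsA : s ∈ ψ.range := hE ▸ right_mem_powNormalizer hr hs
  refine (HNNExtension.pairConj_of_t (φ := φ) ⟨r, hrA⟩ ⟨s, hsA⟩).trans (PairConj.map _ ?_)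
  exact h.conj_of_mem _ _ (hρi ⟨r, hrA⟩ hr) (hρi ⟨s, hsA⟩ hs)
    (fun e => hrs (congrArg Subtype.val (hρ e))) (hB (φ _).2) (hB (φ _).2)

end Amalgamation

section Limit

/-- The composite `G m → G n` of a sequence of homomorphisms. -/
def chainHom {G : ℕ → Type} [∀ n, Group (G n)] (f : ∀ n, G n →* G (n + 1)) (m n : ℕ)
    (h : m ≤ n) : G m →* G n :=
  Nat.leRec (motive := fun n _ => G m →* G n) (MonoidHom.id _) (fun n _ φ => (f n).comp φ) h

variable {G : ℕ → Type} [∀ n, Group (G n)] (f : ∀ n, G n →* G (n + 1))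

lemma chainHom_self (m : ℕ) : chainHom f m m le_rfl = MonoidHom.id _ :=
  Nat.leRec_self _ _

lemma chainHom_succ (m n : ℕ) (h : m ≤ n) :
    chainHom f m (n + 1) (h.trans n.le_succ) = (f n).comp (chainHom f m n h) :=
  Nat.leRec_succ _ _ _

lemma chainHom_comp (m n k : ℕ) (h : m ≤ n) (h' : n ≤ k) :
    (chainHom f n k h').comp (chainHom f m n h) = chainHom f m k (h.trans h') := by
  induction k, h' using Nat.le_induction with
  | base => rw [chainHom_self, MonoidHom.id_comp]
  | succ k h' ih => rw [chainHom_succ _ _ _ h', MonoidHom.comp_assoc, ih, chainHom_succ]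

lemma chainHom_injective (hf : ∀ n, Function.Injective (f n)) (m n : ℕ) (h : m ≤ n) :
    Function.Injective (chainHom f m n h) := by
  induction n, h using Nat.le_induction with
  | base => rw [chainHom_self]; exact Function.injective_id
  | succ n h ih => rw [chainHom_succ _ _ _ h]; exact (hf n).comp ih

/-- A sequence of injective homomorphisms has a limit. -/
lemma exists_limit (hf : ∀ n, Function.Injective (f n)) :
    ∃ (L : Type) (_ : Group L) (i : ∀ n, G n →* L), (∀ n, Function.Injective (i n)) ∧
      (∀ n x, i (n + 1) (f n x) = i n x) ∧ ∀ x, ∃ n y, i n y = x := by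
  have hsys : DirectedSystem G (chainHom f · · ·) :=
    { map_self := fun n x => by rw [chainHom_self]; rfl
      map_map := fun _ _ _ h h' x => DFunLike.congr_fun (chainHom_comp f _ _ _ h h') x }
  let i : ∀ n, G n →* DirectLimit G (chainHom f) := fun n =>
    { toFun := fun x => ⟦⟨n, x⟩⟧
      map_one' := (DirectLimit.one_def n).symm
      map_mul' := fun x y => (DirectLimit.mul_def n x y).symm }
  refine ⟨DirectLimit G (chainHom f), inferInstance, i, fun n => ?_, fun n x => ?_, fun x => ?_⟩
  · exact DirectLimit.mk_injective _ (fun m n h => chainHom_injective f hf m n h) n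
  · have h : chainHom f n (n + 1) n.le_succ x = f n x := by
      rw [chainHom_succ f n n le_rfl, chainHom_self]; rfl
    rw [← h]
    exact DirectLimit.eq_of_le (f := chainHom f) ⟨n, x⟩ (n + 1) n.le_succ |>.symm
  · obtain ⟨n, y, rfl⟩ := DirectLimit.exists_eq_mk (chainHom f) x
    exact ⟨n, y, rfl⟩

end Limit

section Affine

/-- The affine maps `x ↦ m * x + b` of the rational line. -/
@[ext]
structure RatAffine where
  m : ℚˣ
  b : ℚ

namespace RatAffine

instance : Group RatAffine where
  mul x y := ⟨x.m * y.m, x.m * y.b + x.b⟩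
  one := ⟨1, 0⟩
  inv x := ⟨x.m⁻¹, -(x.m⁻¹ * x.b)⟩
  mul_assoc x y z := RatAffine.ext (mul_assoc _ _ _) (by
    change ((x.m * y.m : ℚˣ) : ℚ) * z.b + (x.m * y.b + x.b) = x.m * (y.m * z.b + y.b) + x.b
    push_cast; ring)
  one_mul x := RatAffine.ext (one_mul _) (by
    change ((1 : ℚˣ) : ℚ) * x.b + 0 = x.b
    simp)
  mul_one x := RatAffine.ext (mul_one _) (by
    change (x.m : ℚ) * 0 + x.b = x.b
    simp)
  inv_mul_cancel x := RatAffine.ext (inv_mul_cancel _) (add_neg_cancel _)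

lemma mul_def (x y : RatAffine) : x * y = ⟨x.m * y.m, x.m * y.b + x.b⟩ := rfl

lemma one_def : (1 : RatAffine) = ⟨1, 0⟩ := rfl

instance : Countable RatAffine := by
  refine Function.Injective.countable (f := fun x : RatAffine => ((x.m : ℚ), x.b)) ?_
  intro x y h
  rw [Prod.mk.injEq] at h
  exact RatAffine.ext (Units.ext h.1) h.2

lemma isInvol_iff_m {x : RatAffine} : IsInvol x ↔ x.m = -1 := by
  rw [isInvol_iff, mul_def, one_def, RatAffine.mk.injEq]
  constructor
  · rintro ⟨⟨h1, h2⟩, h3⟩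
    rcases mul_self_eq_one_iff.1 (congrArg Units.val h1) with h | h
    · refine absurd (RatAffine.ext (Units.ext h) ?_) h3
      rw [h] at h2
      change x.b = 0
      linarith
    · exact Units.ext h
  · intro h
    refine ⟨⟨by rw [h]; norm_num, by rw [h]; push_cast; ring⟩, fun e => ?_⟩
    have h1 := congrArg (fun z => (RatAffine.m z : ℚ)) e
    simp only [h] at h1
    norm_num at h1

lemma pow_of_m_eq_one (c : ℚ) (n : ℕ) : (⟨1, c⟩ : RatAffine) ^ n = ⟨1, n * c⟩ := by
  induction n with
  | zero => rw [pow_zero, one_def]; simp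
  | succ n ih => rw [pow_succ, ih, mul_def]; ext <;> push_cast <;> ring

lemma invol_eq {x : RatAffine} (hx : IsInvol x) : x = ⟨-1, x.b⟩ :=
  RatAffine.ext (isInvol_iff_m.1 hx) rfl

lemma conj_eq_iff (g x y : RatAffine) : g * x * g⁻¹ = y ↔ g * x = y * g := mul_inv_eq_iff_eq_mul

lemma isGood : IsGood (⟨-1, 0⟩ : RatAffine) ⟨-1, 1⟩ := by
  have hpair : ∀ r s : RatAffine, IsInvol r → IsInvol s → r ≠ s →
      PairConj r s (⟨-1, 0⟩ : RatAffine) ⟨-1, 1⟩ := fun r s hr hs hrs => by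
    have hb : s.b - r.b ≠ 0 := fun h =>
      hrs (by rw [invol_eq hr, invol_eq hs, sub_eq_zero.1 h])
    refine ⟨⟨Units.mk0 (s.b - r.b)⁻¹ (inv_ne_zero hb), -((s.b - r.b)⁻¹ * r.b) / 2⟩, ?_, ?_⟩
    · rw [conj_eq_iff, mul_def, mul_def, isInvol_iff_m.1 hr]
      ext
      · push_cast; ring
      · push_cast [Units.val_mk0]
        ring
    · rw [conj_eq_iff, mul_def, mul_def, isInvol_iff_m.1 hs]
      ext
      · push_cast; ring
      · push_cast [Units.val_mk0]
        field_simp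
        ring
  refine
  { left := isInvol_iff_m.2 rfl
    right := isInvol_iff_m.2 rfl
    ne := fun h => zero_ne_one (congrArg RatAffine.b h)
    involFree := fun r s hr hs hrs h => ?_
    pair := fun r s hr hs hrs => .inl (hpair r s hr hs hrs)
    conj_of_mem := fun r s hr hs hrs _ _ => hpair r s hr hs hrs
    eq_one := fun g hr hs => ?_ }
  · obtain ⟨n, hn, h⟩ := isOfFinOrder_iff_pow_eq_one.1 h
    have hrs' : r * s = ⟨1, r.b - s.b⟩ := by
      rw [mul_def, isInvol_iff_m.1 hr, isInvol_iff_m.1 hs]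
      ext
      · norm_num
      · push_cast; ring
    rw [hrs', pow_of_m_eq_one] at h
    have h1 := congrArg RatAffine.b h
    rcases mul_eq_zero.1 (h1 : (n : ℚ) * (r.b - s.b) = 0) with h2 | h2
    · exact hn.ne' (Nat.cast_eq_zero.1 h2)
    · exact hrs (by rw [invol_eq hr, invol_eq hs, sub_eq_zero.1 h2])
  · rw [conj_eq_iff, mul_def, mul_def, RatAffine.mk.injEq] at hr hs
    have h1 := hr.2
    have h2 := hs.2
    push_cast at h1 h2
    have h3 : g.b = 0 := by linarith
    refine RatAffine.ext (Units.ext ?_) h3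
    change (g.m : ℚ) = 1
    linarith

end RatAffine

/-- There are two products of distinct involutions that do not commute. -/
def HasNoncommutingTranslations (G : Type*) [Group G] : Prop :=
  ∃ a b c d : G, IsInvol a ∧ IsInvol b ∧ IsInvol c ∧ IsInvol d ∧ a ≠ b ∧ c ≠ d ∧
    a * b * (c * d) ≠ c * d * (a * b)

lemma HasNoncommutingTranslations.map {G H : Type*} [Group G] [Group H]
    (h : HasNoncommutingTranslations G) {f : G →* H} (hf : Function.Injective f) :
    HasNoncommutingTranslations H := by
  obtain ⟨a, b, c, d, ha, hb, hc, hd, hab, hcd, hne⟩ := h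
  refine ⟨f a, f b, f c, f d, (IsInvol.map_iff hf).2 ha, (IsInvol.map_iff hf).2 hb,
    (IsInvol.map_iff hf).2 hc, (IsInvol.map_iff hf).2 hd, hf.ne hab, hf.ne hcd, ?_⟩
  simpa only [map_mul] using hf.ne hne

open HNNExtension in
/-- Adjoining a free letter to a good group makes some translations noncommuting. -/
lemma IsGood.exists_hasNoncommutingTranslations {G : Type} [Group G] [Countable G] {r₀ s₀ : G}
    (h : IsGood r₀ s₀) : ∃ (Γ : Type) (_ : Group Γ) (_ : Countable Γ) (r s : Γ),
      IsGood r s ∧ HasNoncommutingTranslations Γ := by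
  let φ : (⊥ : Subgroup G) ≃* (⊥ : Subgroup G) := MulEquiv.refl _
  have hnot : ∀ p : G, IsTranslationPow p → p ∉ (⊥ : Subgroup G) := fun p hp hp1 =>
    hp.not_isOfFinOrder h.involFree (Subgroup.mem_bot.1 hp1 ▸ IsOfFinOrder.one)
  have hA : Admissible (⊥ : Subgroup G) ⊥ :=
    { mul_self_eq_one_or := fun x hx => .inl (by rw [Subgroup.mem_bot.1 hx, one_mul])
      mem_left := fun p _ hp hp1 => absurd hp1 (hnot p hp)
      notMem := fun p _ hp hp1 => absurd hp1 (hnot p hp) }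
  have h₀ : ∀ n : ℤ, n ≠ 0 → ∀ g, g⁻¹ * (r₀ * s₀) ^ n * g ∉ (⊥ : Subgroup G) := fun n hn g =>
    hnot _ (IsTranslationPow.conj ⟨_, _, n, h.left, h.right, h.ne, hn, rfl⟩ g)
  have hgood := HNNExtension.isGood (φ := φ) h hA h₀
  refine ⟨HNNExtension G ⊥ ⊥ φ, inferInstance, inferInstance, of r₀, of s₀, hgood, ?_⟩
  have hu := hgood.left.conj t
  have hrange : t * of r₀ * t⁻¹ ∉ (of : G →* HNNExtension G ⊥ ⊥ φ).range := by
    rintro ⟨c, hc⟩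
    have hE : Edge (base : Vertex G ⊥ ⊥ φ) (t • base) := ⟨1, (one_smul _ _).symm, by rw [one_mul]⟩
    obtain ⟨g, a, -, -, hg⟩ := hE.exists_eq_of_smul_eq (k := of c) (smul_base_eq_iff.2 ⟨c, rfl⟩)
      (by
        rw [hc, smul_smul, inv_mul_cancel_right, mul_smul]
        exact congrArg (t • ·) (smul_base_eq_iff.2 ⟨_, rfl⟩))
    rw [Subgroup.mem_bot.1 (φ a).2, map_one, mul_one, mul_inv_cancel, hc] at hg
    exact hu.ne_one hg
  have hne : of r₀ ≠ (t * of r₀ * t⁻¹ : HNNExtension G ⊥ ⊥ φ) := fun e => hrange (e ▸ ⟨r₀, rfl⟩)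
  refine ⟨of r₀, of s₀, of r₀, t * of r₀ * t⁻¹, hgood.left, hgood.right, hgood.left, hu, hgood.ne,
    hne, fun hcomm => hrange ?_⟩
  have hmem : of r₀ * (t * of r₀ * t⁻¹) ∈ powNormalizer (of r₀ * of s₀ : HNNExtension G ⊥ ⊥ φ) := by
    refine ⟨1, 1, one_ne_zero, one_ne_zero, ?_⟩
    rw [zpow_one, ← hcomm, mul_inv_cancel_right]
  rw [← map_mul, powNormalizer_of hA (h.involFree _ _ h.left h.right h.ne) h₀] at hmem
  obtain ⟨c, -, hc⟩ := hmem
  exact ⟨r₀⁻¹ * c, by rw [map_mul, hc, map_inv, inv_mul_cancel_left]⟩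

end Affine

section Tower

/-- A countable good group together with a list of pairs of elements to be processed. -/
structure Stage where
  carrier : Type
  [group : Group carrier]
  [countable : Countable carrier]
  r : carrier
  s : carrier
  good : IsGood r s
  task : ℕ → carrier × carrier

attribute [instance] Stage.group Stage.countable

lemma Stage.exists_next (n : ℕ) (S : Stage) : ∃ (T : Stage) (f : S.carrier →* T.carrier),
    Function.Injective f ∧ f S.r = T.r ∧ f S.s = T.s ∧
    (IsInvol (S.task n).1 → IsInvol (S.task n).2 → (S.task n).1 ≠ (S.task n).2 →
      PairConj (f (S.task n).1) (f (S.task n).2) T.r T.s) ∧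
    (∀ k, k.unpair.1 ≤ n → T.task k = (f (S.task k).1, f (S.task k).2)) ∧
    ∀ p, ∃ k, k.unpair.1 = n + 1 ∧ T.task k = p := by
  obtain ⟨Γ, _, _, f, hf, hgood, hconj⟩ : ∃ (Γ : Type) (_ : Group Γ) (_ : Countable Γ)
      (f : S.carrier →* Γ), Function.Injective f ∧ IsGood (f S.r) (f S.s) ∧
      (IsInvol (S.task n).1 → IsInvol (S.task n).2 → (S.task n).1 ≠ (S.task n).2 →
        PairConj (f (S.task n).1) (f (S.task n).2) (f S.r) (f S.s)) := by
    by_cases h : IsInvol (S.task n).1 ∧ IsInvol (S.task n).2 ∧ (S.task n).1 ≠ (S.task n).2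
    · obtain ⟨Γ, i, j, f, hf, hgood, hc⟩ := S.good.exists_pairConj h.1 h.2.1 h.2.2
      exact ⟨Γ, i, j, f, hf, hgood, fun _ _ _ => hc⟩
    · exact ⟨S.carrier, _, S.countable, MonoidHom.id _, Function.injective_id, S.good,
        fun h1 h2 h3 => absurd ⟨h1, h2, h3⟩ h⟩
  obtain ⟨e, he⟩ := exists_surjective_nat (Γ × Γ)
  refine ⟨⟨Γ, f S.r, f S.s, hgood, fun k => if k.unpair.1 ≤ n then
    (f (S.task k).1, f (S.task k).2) else e k.unpair.2⟩, f, hf, rfl, rfl, hconj,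
    fun k hk => if_pos hk, fun p => ?_⟩
  obtain ⟨j, rfl⟩ := he p
  refine ⟨Nat.pair (n + 1) j, by rw [Nat.unpair_pair], ?_⟩
  simp

/-- A countable good group embeds in a group in which all pairs of distinct involutions are
conjugate. -/
lemma IsGood.exists_limit {G : Type} [Group G] [Countable G] {r₀ s₀ : G} (h : IsGood r₀ s₀) :
    ∃ (L : Type) (_ : Group L) (f : G →* L), Function.Injective f ∧ InvolFree L ∧
      (∀ r s : L, IsInvol r → IsInvol s → r ≠ s → PairConj r s (f r₀) (f s₀)) ∧
      ∀ g : L, g * f r₀ * g⁻¹ = f r₀ → g * f s₀ * g⁻¹ = f s₀ → g = 1 := by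
  obtain ⟨e, he⟩ := exists_surjective_nat (G × G)
  let S₀ : Stage := ⟨G, r₀, s₀, h, fun k => e k.unpair.2⟩
  choose next f hf hr hs hconj hold hnew using Stage.exists_next
  let S : ℕ → Stage := fun n => Nat.rec (motive := fun _ => Stage) S₀ next n
  obtain ⟨L, _, i, hi, hcomp, hsurj⟩ :=
    _root_.exists_limit (fun n => (f n (S n) : (S n).carrier →* (S (n + 1)).carrier))
      fun n => hf n (S n)
  have hir : ∀ n, i n (S n).r = i 0 r₀ := fun n => by
    induction n with
    | zero => rfl
    | succ n ih => exact (congrArg (i (n + 1)) (hr n (S n)).symm).trans ((hcomp n _).trans ih)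
  have his : ∀ n, i n (S n).s = i 0 s₀ := fun n => by
    induction n with
    | zero => rfl
    | succ n ih => exact (congrArg (i (n + 1)) (hs n (S n)).symm).trans ((hcomp n _).trans ih)
  have hmono : ∀ m n, m ≤ n → ∀ x, ∃ y, i n y = i m x := fun m n hmn => by
    induction n, hmn using Nat.le_induction with
    | base => exact fun x => ⟨x, rfl⟩
    | succ n hmn ih => exact fun x => (ih x).imp' _ fun y hy => (hcomp n y).trans hy
  have hsurj₂ : ∀ x y, ∃ n x' y', i n x' = x ∧ i n y' = y := fun x y => by
    obtain ⟨m, x, rfl⟩ := hsurj x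
    obtain ⟨n, y, rfl⟩ := hsurj y
    obtain ⟨x', hx⟩ := hmono m (max m n) (le_max_left _ _) x
    obtain ⟨y', hy⟩ := hmono n (max m n) (le_max_right _ _) y
    exact ⟨_, x', y', hx, hy⟩
  have htask : ∀ k n, k.unpair.1 ≤ n →
      (i n ((S n).task k).1, i n ((S n).task k).2) =
        (i k.unpair.1 ((S k.unpair.1).task k).1, i k.unpair.1 ((S k.unpair.1).task k).2) :=
      fun k n hn => by
    induction n, hn using Nat.le_induction with
    | base => rfl
    | succ n hn ih =>
      exact (congrArg (fun p : (S (n + 1)).carrier × (S (n + 1)).carrier =>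
        (i (n + 1) p.1, i (n + 1) p.2)) (hold n (S n) k hn)).trans
        ((Prod.ext (hcomp n _) (hcomp n _)).trans ih)
  have hsurjTask : ∀ n p, ∃ k, k.unpair.1 = n ∧ (S n).task k = p := fun n => by
    cases n with
    | zero =>
      intro p
      obtain ⟨j, hj⟩ := he p
      refine ⟨Nat.pair 0 j, by rw [Nat.unpair_pair], ?_⟩
      change e (Nat.pair 0 j).unpair.2 = p
      rw [Nat.unpair_pair, hj]
    | succ n => exact hnew n (S n)
  refine ⟨L, _, i 0, hi 0, fun r s hr' hs' hrs => ?_, fun r s hr' hs' hrs => ?_, fun g hgr hgs => ?_⟩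
  · obtain ⟨n, r, s, rfl, rfl⟩ := hsurj₂ r s
    rw [← map_mul, (hi n).isOfFinOrder_iff]
    exact (S n).good.involFree r s ((IsInvol.map_iff (hi n)).1 hr')
      ((IsInvol.map_iff (hi n)).1 hs') fun e => hrs (by rw [e])
  · obtain ⟨n, r, s, rfl, rfl⟩ := hsurj₂ r s
    obtain ⟨k, rfl, hk⟩ := hsurjTask n (r, s)
    have := htask k k (Nat.unpair_left_le k)
    rw [hk, Prod.mk.injEq] at this
    obtain ⟨h1, h2⟩ := this
    dsimp only at h1 h2
    rw [← h1] at hr' hrs ⊢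
    rw [← h2] at hs' hrs ⊢
    rw [IsInvol.map_iff (hi k)] at hr' hs'
    have := (hconj k (S k) hr' hs' fun e => hrs (by rw [e])).map (i (k + 1))
    rwa [hcomp, hcomp, hir (k + 1), his (k + 1)] at this
  · obtain ⟨n, g, rfl⟩ := hsurj g
    rw [← hir n, ← map_inv, ← map_mul, ← map_mul] at hgr
    rw [← his n, ← map_inv, ← map_mul, ← map_mul] at hgs
    rw [(S n).good.eq_one g (hi n hgr) (hi n hgs), map_one]

end Tower

/-- there exists a sharply 2-transitive group of characteristic 0 with no
nontrivial abelian normal subgroup. -/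
theorem exists_sharply_two_transitive_char_zero :
    ∃ (𝒢 : Type) (_ : Group 𝒢),
      (∃ r s : 𝒢, IsInvol r ∧ IsInvol s ∧ r ≠ s) ∧
      (∀ r s : 𝒢, IsInvol r → IsInvol s → r ≠ s → ¬ IsOfFinOrder (r * s)) ∧
      (∀ a b c d : 𝒢, IsInvol a → IsInvol b → IsInvol c → IsInvol d → a ≠ b → c ≠ d →
        ∃! g : 𝒢, g⁻¹ * a * g = c ∧ g⁻¹ * b * g = d) ∧
      (∀ N : Subgroup 𝒢, N.Normal → (∀ x ∈ N, ∀ y ∈ N, x * y = y * x) → N = ⊥) := by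
  obtain ⟨Γ, _, _, r₀, s₀, hgood, hnc⟩ := RatAffine.isGood.exists_hasNoncommutingTranslations
  obtain ⟨L, _, f, hf, hfree, hpair, hone⟩ := hgood.exists_limit
  have hr := (IsInvol.map_iff hf).2 hgood.left
  have hs := (IsInvol.map_iff hf).2 hgood.right
  have hrs := hf.ne hgood.ne
  replace hnc := hnc.map hf
  generalize f r₀ = r at *
  generalize f s₀ = s at *
  refine ⟨L, _, ⟨r, s, hr, hs, hrs⟩, hfree, fun a b c d ha hb hc hd hab hcd => ?_,
    fun N hN hcomm => ?_⟩
  · obtain ⟨g, hga, hgb⟩ := (hpair a b ha hb hab).trans (hpair c d hc hd hcd).symm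
    obtain ⟨k, hka, hkb⟩ := hpair a b ha hb hab
    refine ⟨g⁻¹, ⟨by rwa [inv_inv], by rwa [inv_inv]⟩, fun x ⟨hxa, hxb⟩ => ?_⟩
    have h1 : k * (x * g) * k⁻¹ = 1 := by
      refine hone _ ?_ ?_
      · calc _ = k * (x * (g * (k⁻¹ * r * k) * g⁻¹) * x⁻¹) * k⁻¹ := by group
          _ = r := by
            rw [show k⁻¹ * r * k = a by rw [← hka]; group, hga, ← hxa, ← hka]; group
      · calc _ = k * (x * (g * (k⁻¹ * s * k) * g⁻¹) * x⁻¹) * k⁻¹ := by group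
          _ = s := by
            rw [show k⁻¹ * s * k = b by rw [← hkb]; group, hgb, ← hxb, ← hkb]; group
    exact eq_inv_of_mul_eq_one_left (conj_eq_one_iff.1 h1)
  · by_contra hbot
    obtain ⟨n, hn, hn1⟩ := N.bot_or_exists_ne_one.resolve_left hbot
    obtain ⟨j, hj, hjn⟩ : ∃ j, IsInvol j ∧ j ≠ n * j * n⁻¹ := by
      by_contra! hall
      exact hn1 (hone n (hall r hr).symm (hall s hs).symm)
    have hmem : j * (n * j * n⁻¹) ∈ N := by
      have h1 := N.mul_mem (hN.conj_mem n hn j) (N.inv_mem hn)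
      rw [hj.inv_eq] at h1
      simpa only [mul_assoc] using h1
    have htrans : ∀ a b : L, IsInvol a → IsInvol b → a ≠ b → a * b ∈ N := fun a b ha hb hab => by
      obtain ⟨g, hga, hgb⟩ := (hpair _ _ hj (hj.conj n) hjn).trans (hpair a b ha hb hab).symm
      rw [← hga, ← hgb]
      have h1 := hN.conj_mem _ hmem g
      rwa [show g * (j * (n * j * n⁻¹)) * g⁻¹ = g * j * g⁻¹ * (g * (n * j * n⁻¹) * g⁻¹) by group]
        at h1
    obtain ⟨a, b, c, d, ha, hb, hc, hd, hab, hcd, hne⟩ := hnc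
    exact hne (hcomm _ (htrans a b ha hb hab) _ (htrans c d hc hd hcd))
end

section
/- Under the standing hypotheses, if s₁, s₂, s₃ are involutions of G, each distinct from j, with s₁ ≠ s₂ and s₁·s₂ ∈ ⟨j, s₃⟩, then s₁ ∼_j s₃ and s₂ ∼_j s₃. -/
namespace IsInvol

variable {G : Type*} [Group G] {r s x : G}

theorem mul_self_s7 (h : IsInvol s) : s * s = 1 := by
  rw [← pow_two, ← h, pow_orderOf_eq_one]

theorem inv_eq_s7 (h : IsInvol s) : s⁻¹ = s :=
  inv_eq_of_mul_eq_one_left h.mul_self_s7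

theorem of_mul_self (h : s * s = 1) (h1 : s ≠ 1) : IsInvol s :=
  orderOf_eq_prime (by rw [pow_two, h]) h1

/-- An involution `r` inverts every power of `r * s`. -/
theorem zpow_mul (hr : IsInvol r) (hs : IsInvol s) (n : ℤ) :
    (r * s) ^ n * r = r * (r * s) ^ (-n) := by
  have h : r * (r * s) * r⁻¹ = (r * s)⁻¹ := by
    rw [mul_inv_rev, hr.inv_eq_s7, hs.inv_eq_s7, ← mul_assoc, hr.mul_self_s7, one_mul]
  rw [zpow_neg, ← inv_zpow, ← h, conj_zpow, hr.inv_eq_s7]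
  simp only [← mul_assoc, hr.mul_self_s7, one_mul]

/-- Every element of the dihedral group `⟨r, s⟩` is a power of `r * s`, or `r` times one. -/
theorem mem_closure_pair (hr : IsInvol r) (hs : IsInvol s)
    (hx : x ∈ Subgroup.closure ({r, s} : Set G)) :
    ∃ n : ℤ, x = (r * s) ^ n ∨ x = r * (r * s) ^ n := by
  induction hx using Subgroup.closure_induction with
  | mem x hx =>
    rcases hx with rfl | rfl
    · exact ⟨0, Or.inr (by simp)⟩
    · exact ⟨1, Or.inr (by rw [zpow_one, ← mul_assoc, hr.mul_self_s7, one_mul])⟩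
  | one => exact ⟨0, Or.inl (by simp)⟩
  | mul x y _ _ hx hy =>
    obtain ⟨m, rfl | rfl⟩ := hx <;> obtain ⟨n, rfl | rfl⟩ := hy
    · exact ⟨m + n, Or.inl (zpow_add _ _ _).symm⟩
    · exact ⟨-m + n, Or.inr (by rw [← mul_assoc, zpow_mul hr hs, mul_assoc, zpow_add])⟩
    · exact ⟨m + n, Or.inr (by rw [mul_assoc, zpow_add])⟩
    · refine ⟨-m + n, Or.inl ?_⟩
      rw [mul_assoc, ← mul_assoc _ r, zpow_mul hr hs, mul_assoc, ← mul_assoc r r, hr.mul_self_s7,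
        one_mul, zpow_add]
  | inv x _ hx =>
    obtain ⟨m, rfl | rfl⟩ := hx
    · exact ⟨-m, Or.inl (zpow_neg _ _).symm⟩
    · refine ⟨m, Or.inr ?_⟩
      rw [mul_inv_rev, hr.inv_eq_s7, ← zpow_neg, zpow_mul hr hs, neg_neg]

end IsInvol

/-- An element `r ≠ j` inverting a nontrivial power of `j * s` is equivalent to `s`. -/
theorem StandingHyp.jEquiv_of_conj_zpow {G : Type*} [Group G] {j t t' : G}
    (H : StandingHyp j t t') {r s : G} (hs : IsInvol s) (hrj : r ≠ j)
    (hsj : s ≠ j) {n : ℤ} (hn : n ≠ 0) (hinv : r * (j * s) ^ n = (j * s) ^ (-n) * r) :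
    JEquiv j r s := by
  have hj := H.invol_j
  have hfin := H.infinite_order j s hj hs hsj.symm
  have hne : ∀ k : ℤ, k ≠ 0 → (j * s) ^ k ≠ 1 := fun k hk h =>
    hfin (isOfFinOrder_iff_zpow_eq_one.2 ⟨k, hk, h⟩)
  have hju : j * (j * (j * s) ^ n) = (j * s) ^ n := by
    rw [← mul_assoc, hj.mul_self_s7, one_mul]
  have hu : IsInvol (j * (j * s) ^ n) := by
    refine .of_mul_self ?_ fun h => ?_
    · rw [mul_assoc, ← mul_assoc _ j, hj.zpow_mul hs, mul_assoc, ← zpow_add, neg_add_cancel,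
        zpow_zero, mul_one, hj.mul_self_s7]
    · refine hne (n + n) (by lia) ?_
      rw [h, mul_one] at hju
      rw [zpow_add, ← hju, hj.mul_self_s7]
  have huj : j * (j * s) ^ n ≠ j := fun h => hne n hn (mul_eq_left.1 h)
  have hcomm : j * r ∈ Subgroup.centralizer ({j * (j * (j * s) ^ n)} : Set G) := by
    rw [hju, Subgroup.mem_centralizer_singleton_iff, mul_assoc, hinv, ← mul_assoc,
      ← hj.zpow_mul hs, mul_assoc]
  rcases (H.centralizer_eq _ hu huj _).1 hcomm with h | ⟨r', -, ⟨k, l, hk, hl, hkl⟩, h⟩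
  · exact absurd (by rw [eq_inv_of_mul_eq_one_right h, hj.inv_eq_s7]) hrj
  · obtain rfl := mul_left_cancel h
    exact ⟨k, n * l, hk, mul_ne_zero hn hl, by rw [hkl, hju, zpow_mul]⟩

/-- if `s₁·s₂ ∈ ⟨j, s₃⟩` for involutions `s₁, s₂, s₃ ≠ j` with `s₁ ≠ s₂`,
then `s₁` and `s₂` are equivalent to `s₃` relative to `j`. -/
theorem translation_product {G : Type*} [Group G] (j t t' : G)
    (H : StandingHyp j t t') (s₁ s₂ s₃ : G)
    (h₁ : IsInvol s₁) (h₂ : IsInvol s₂) (h₃ : IsInvol s₃)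
    (h₁j : s₁ ≠ j) (h₂j : s₂ ≠ j) (h₃j : s₃ ≠ j) (h₁₂ : s₁ ≠ s₂)
    (hmem : s₁ * s₂ ∈ Subgroup.closure ({j, s₃} : Set G)) :
    JEquiv j s₁ s₃ ∧ JEquiv j s₂ s₃ := by
 
  have hj := H.invol_j
  have hfin := H.infinite_order s₁ s₂ h₁ h₂ h₁₂
  obtain ⟨n, hn | hn⟩ := hj.mem_closure_pair h₃ hmem
  · have hn0 : n ≠ 0 := by
      rintro rfl
      exact hfin (by rw [hn, zpow_zero]; exact IsOfFinOrder.one)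
    constructor
    · refine H.jEquiv_of_conj_zpow h₃ h₁j h₃j hn0 ?_
      rw [zpow_neg, ← hn, mul_inv_rev, h₁.inv_eq_s7, h₂.inv_eq_s7, ← mul_assoc, mul_assoc s₂,
        h₁.mul_self_s7, one_mul, mul_one]
    · refine H.jEquiv_of_conj_zpow h₃ h₂j h₃j hn0 ?_
      rw [zpow_neg, ← hn, mul_inv_rev, h₁.inv_eq_s7, h₂.inv_eq_s7, mul_assoc]
  · refine absurd (isOfFinOrder_iff_pow_eq_one.2 ⟨2, two_pos, ?_⟩) hfin
    rw [hn, pow_two, mul_assoc, ← mul_assoc _ j, hj.zpow_mul h₃, mul_assoc, ← zpow_add,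
      neg_add_cancel, zpow_zero, mul_one, hj.mul_self_s7]
end

section
/- Under the standing hypotheses, for every involution s ∈ G and every integer n > 0, there is at most one involution s₁ ∈ G with (j·s₁)^n = j·s. In particular, if s₁, s₂ are involutions with (j·s₁)^n = (j·s₂)^n for some n > 0, then s₁ = s₂. -/
theorem IsInvol.mul_self_s10 {G : Type*} [Group G] {s : G} (hs : IsInvol s) : s * s = 1 := by
  rw [← pow_two, ← orderOf_dvd_iff_pow_eq_one, show orderOf s = 2 from hs]

theorem IsInvol.ne_one_s10 {G : Type*} [Group G] {s : G} (hs : IsInvol s) : s ≠ 1 := by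
  rintro rfl
  simp [IsInvol] at hs

theorem IsInvol.inv_eq_s10 {G : Type*} [Group G] {s : G} (hs : IsInvol s) : s⁻¹ = s :=
  inv_eq_of_mul_eq_one_left hs.mul_self_s10

theorem isInvol_of_mul_self {G : Type*} [Group G] {s : G} (h : s * s = 1) (hs : s ≠ 1) :
    IsInvol s :=
  orderOf_eq_prime (by rw [pow_two, h]) hs

/-- Conjugation by `j` inverts the products `j * s` of involutions. -/
theorem IsInvol.conj_mul {G : Type*} [Group G] {j s : G} (hj : IsInvol j) (hs : IsInvol s) :
    j * (j * s) * j⁻¹ = (j * s)⁻¹ := by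
  rw [mul_inv_rev, hj.inv_eq_s10, hs.inv_eq_s10, ← mul_assoc j j s, hj.mul_self_s10, one_mul]

namespace StandingHyp

variable {G : Type*} [Group G] {j t t' : G}

/-- A product of two involutions that has a trivial positive power is trivial. -/
theorem eq_of_pow_eq_one (H : StandingHyp j t t') {r s : G} (hr : IsInvol r) (hs : IsInvol s)
    {n : ℕ} (hn : 0 < n) (h : (r * s) ^ n = 1) : r = s := by
  by_contra hne
  exact H.infinite_order r s hr hs hne (isOfFinOrder_iff_pow_eq_one.2 ⟨n, hn, h⟩)

/-- The centralizer of `j * s` is inverted elementwise by `j`. -/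
theorem conj_eq_inv_of_mem_centralizer (H : StandingHyp j t t') {s : G} (hs : IsInvol s)
    (hsj : s ≠ j) {x : G} (hx : x ∈ Subgroup.centralizer ({j * s} : Set G)) :
    j * x * j⁻¹ = x⁻¹ := by
  rcases (H.centralizer_eq s hs hsj x).1 hx with rfl | ⟨s', hs', -, rfl⟩
  · simp
  · exact H.invol_j.conj_mul hs'

/-- The centralizer of `j * s` is abelian. -/
theorem commute_of_mem_centralizer (H : StandingHyp j t t') {s : G} (hs : IsInvol s)
    (hsj : s ≠ j) {x y : G} (hx : x ∈ Subgroup.centralizer ({j * s} : Set G))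
    (hy : y ∈ Subgroup.centralizer ({j * s} : Set G)) : Commute x y := by
  have h := H.conj_eq_inv_of_mem_centralizer hs hsj (mul_mem hx hy)
  rw [← conj_mul, H.conj_eq_inv_of_mem_centralizer hs hsj hx,
    H.conj_eq_inv_of_mem_centralizer hs hsj hy, ← mul_inv_rev, inv_inj] at h
  exact h.symm

theorem root_unique (H : StandingHyp j t t') {s s₁ s₂ : G} (hs : IsInvol s) {n : ℕ} (hn : 0 < n)
    (hs₁ : IsInvol s₁) (hs₂ : IsInvol s₂) (h₁ : (j * s₁) ^ n = j * s)
    (h₂ : (j * s₂) ^ n = j * s) : s₁ = s₂ := by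
  by_cases hsj : s = j
  · rw [hsj, H.invol_j.mul_self_s10] at h₁ h₂
    rw [← H.eq_of_pow_eq_one H.invol_j hs₁ hn h₁, H.eq_of_pow_eq_one H.invol_j hs₂ hn h₂]
  · have mem : ∀ {r : G}, (j * r) ^ n = j * s →
        j * r ∈ Subgroup.centralizer ({j * s} : Set G) := fun hr ↦ by
      rw [Subgroup.mem_centralizer_singleton_iff, ← hr]
      exact Commute.self_pow _ _
    have hc := (H.commute_of_mem_centralizer hs hsj (mem h₁) (mem h₂)).inv_right
    have h := hc.mul_pow n
    rw [inv_pow, h₁, h₂, mul_inv_cancel, mul_inv_rev, hs₂.inv_eq_s10,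
      show j * s₁ * (s₂ * j⁻¹) = j * (s₁ * s₂) * j⁻¹ by group, conj_pow, conj_eq_one_iff] at h
    exact H.eq_of_pow_eq_one hs₁ hs₂ hn h

/-- Positive powers of `j * s` are again products of `j` with an involution. -/
theorem exists_pow_eq (H : StandingHyp j t t') {s : G} (hs : IsInvol s) {n : ℕ} (hn : 0 < n) :
    ∃ r, IsInvol r ∧ (j * s) ^ n = j * r := by
  have hconj : j * (j * s) ^ n * j⁻¹ = ((j * s) ^ n)⁻¹ := by
    rw [← conj_pow, H.invol_j.conj_mul hs, inv_pow]
  refine ⟨j⁻¹ * (j * s) ^ n, isInvol_of_mul_self ?_ fun h ↦ ?_, by group⟩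
  · nth_rewrite 1 [H.invol_j.inv_eq_s10]
    rw [← mul_assoc, hconj, inv_mul_cancel]
  · have hj : (j * s) ^ n = j := (inv_mul_eq_one.1 h).symm
    have hsj : j = s := H.eq_of_pow_eq_one H.invol_j hs (Nat.mul_pos hn two_pos)
      (by rw [pow_mul, hj, pow_two, H.invol_j.mul_self_s10])
    subst hsj
    rw [H.invol_j.mul_self_s10, one_pow] at hj
    exact H.invol_j.ne_one_s10 hj.symm

end StandingHyp

/-- for any involution `s` and `n > 0` there is at most one involution `s₁`
with `(j·s₁)^n = j·s`; in particular `(j·s₁)^n = (j·s₂)^n` implies `s₁ = s₂`. -/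
theorem linear_roots {G : Type*} [Group G] (j t t' : G)
    (H : StandingHyp j t t') :
    (∀ s : G, IsInvol s → ∀ n : ℕ, 0 < n → ∀ s₁ s₂ : G, IsInvol s₁ → IsInvol s₂ →
        (j * s₁) ^ n = j * s → (j * s₂) ^ n = j * s → s₁ = s₂) ∧
    (∀ n : ℕ, 0 < n → ∀ s₁ s₂ : G, IsInvol s₁ → IsInvol s₂ →
        (j * s₁) ^ n = (j * s₂) ^ n → s₁ = s₂) := by
  refine ⟨fun s hs n hn s₁ s₂ hs₁ hs₂ ↦ H.root_unique hs hn hs₁ hs₂,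
    fun n hn s₁ s₂ hs₁ hs₂ h ↦ ?_⟩
  obtain ⟨s, hs, hs'⟩ := H.exists_pow_eq hs₁ hn
  exact H.root_unique hs hn hs₁ hs₂ hs' (h ▸ hs')
end

section
/- Let G be a group, H and K subgroups of G, φ : H ≃* K an isomorphism, G₁ the HNN extension of G over (H, K, φ), and ι : G →* G₁ the canonical embedding. If g ∈ G and h ∈ G₁ satisfy h⁻¹·ι(g)·h ∈ ι(G), then h ∈ ι(G) or there exists b ∈ G with b⁻¹·g·b ∈ H ∪ K. In particular, if the centralizer of ι(g) in G₁ is not contained in ι(G), then there exists b ∈ G with b⁻¹·g·b ∈ H ∪ K. -/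
namespace HNNExtension.ReducedWord

open NormalWord

variable {G : Type*} [Group G] {H K : Subgroup G}

/-- Every element of an HNN extension is the product of a reduced word. -/
theorem exists_prod_eq (φ : H ≃* K) (x : HNNExtension G H K φ) :
    ∃ w : ReducedWord G H K, w.prod φ = x := by
  obtain ⟨d⟩ := TransversalPair.nonempty G H K
  exact ⟨((NormalWord.equiv φ d) x).toReducedWord, (NormalWord.equiv φ d).symm_apply_apply x⟩

/-- Right multiplication by an element of the base group only changes the last letter of a
reduced word in which the stable letter occurs. -/
theorem exists_prod_eq_prod_mul_of (φ : H ≃* K) (w : ReducedWord G H K) (hw : w.toList ≠ [])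
    (k : G) : ∃ w' : ReducedWord G H K, w'.head = w.head ∧ w'.prod φ = w.prod φ * of k := by
  obtain ⟨x, l, hl⟩ := w
  obtain ⟨l, ⟨u, y⟩, rfl⟩ := List.eq_nil_or_concat l |>.resolve_left hw
  refine ⟨⟨x, l ++ [(u, y * k)], ?_⟩, rfl, ?_⟩
  · simpa [List.isChain_append] using hl
  · simp [ReducedWord.prod, mul_assoc]

end HNNExtension.ReducedWord

/-- If a conjugator `h` takes an element `g` of the base group into the base group, then `h` lies
in the base group or `g` is conjugate in the base group into an associated subgroup. -/
theorem HNNExtension.mem_range_of_or_exists_conj_mem {G : Type*} [Group G] {H K : Subgroup G}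
    {φ : H ≃* K} {g : G} {h : HNNExtension G H K φ}
    (hg : h⁻¹ * of g * h ∈ (of : G →* HNNExtension G H K φ).range) :
    h ∈ (of : G →* HNNExtension G H K φ).range ∨
      ∃ b : G, b⁻¹ * g * b ∈ H ∨ b⁻¹ * g * b ∈ K := by
  obtain ⟨k, hk⟩ := hg
  obtain ⟨w, rfl⟩ := ReducedWord.exists_prod_eq φ h
  by_cases hw : w.toList = []
  · exact Or.inl ⟨w.head, by simp [NormalWord.ReducedWord.prod, hw]⟩
  obtain ⟨w', hhead, hprod⟩ := ReducedWord.exists_prod_eq_prod_mul_of φ w hw k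
  let v : NormalWord.ReducedWord G H K := { w with head := g * w.head }
  have hv : v.prod φ = w'.prod φ := by
    rw [hprod, hk]
    simp [v, NormalWord.ReducedWord.prod, mul_assoc]
  obtain ⟨a, l, hl⟩ := List.exists_cons_of_ne_nil hw
  have hmem := (ReducedWord.map_fst_eq_and_of_prod_eq φ hv).2 a.1 (by simp [v, hl])
  rw [← inv_mem_iff] at hmem
  have hconj : w.head⁻¹ * g * w.head ∈ toSubgroup H K (-a.1) := by
    simpa [v, hhead, mul_assoc] using hmem
  refine Or.inr ⟨w.head, ?_⟩
  rcases Int.units_eq_one_or a.1 with ha | ha <;> simp only [ha, neg_neg] at hconj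
  · exact Or.inr hconj
  · exact Or.inl hconj

/-- if `g ∈ G`, `h ∈ G₁ = HNNExtension G H K φ` and `h⁻¹·ι(g)·h ∈ ι(G)`,
then `h ∈ ι(G)` or some `G`-conjugate of `g` lies in `H ∪ K`; in particular the same
conclusion holds if the centralizer of `ι(g)` is not contained in `ι(G)`. -/
theorem hnn_conj_into_base {G : Type*} [Group G] (H K : Subgroup G) (φ : H ≃* K) (g : G) :
    (∀ h : HNNExtension G H K φ,
        h⁻¹ * HNNExtension.of g * h ∈ (HNNExtension.of : G →* HNNExtension G H K φ).range →
        h ∈ (HNNExtension.of : G →* HNNExtension G H K φ).range ∨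
          ∃ b : G, b⁻¹ * g * b ∈ H ∨ b⁻¹ * g * b ∈ K) ∧
    (¬ Subgroup.centralizer ({HNNExtension.of g} : Set (HNNExtension G H K φ)) ≤
        (HNNExtension.of : G →* HNNExtension G H K φ).range →
      ∃ b : G, b⁻¹ * g * b ∈ H ∨ b⁻¹ * g * b ∈ K) := by
  refine ⟨fun _ => HNNExtension.mem_range_of_or_exists_conj_mem, fun hc => ?_⟩
  obtain ⟨h, hh, hrange⟩ := SetLike.not_le_iff_exists.1 hc
  refine (HNNExtension.mem_range_of_or_exists_conj_mem ⟨g, ?_⟩).resolve_left hrange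
  rw [mul_assoc, ← Subgroup.mem_centralizer_singleton_iff.1 hh, inv_mul_cancel_left]
end
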